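/- arXiv:math/0211419 — 2 statements merged into one kernel-verified Lean document; each statement's English description precedes it below -/
import Mathlib

section
/- The restriction of any universal LD^meas Laver function to the class of weakly compact cardinals that are not measurable still witnesses LD^meas: if ℓ : Ord → V is a universal LD^meas Laver function and ℓ* is its restriction to the non-measurable weakly compact cardinals, then for every measurable cardinal κ the function ℓ*↾κ is a LD^meas_κ Laver function. -/
open FirstOrder

universe u

namespace LaverDiamond

/-- The relation symbols of the language of set theory: a single binary relation `mem`. -/
inductive memRel : ℕ → Type
  | mem : memRel 2

/-- The first-order language of set theory. -/
def SetLang : FirstOrder.Language := ⟨fun _ => Empty, memRel⟩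

/-- Any class of ZF-sets is a structure in the language of set theory, with the true
membership relation. -/
instance classStructure (M : Set ZFSet.{u}) : SetLang.Structure M where
  funMap := fun {_} f _ => f.elim
  RelMap := fun {_} r x => match r with
    | .mem => (x 0 : ZFSet) ∈ (x 1 : ZFSet)

/-- A (fully) elementary embedding from the class `M` to the class `N`, both classes of
ZF-sets equipped with the true membership relation.  It is coded by a global function
`j : ZFSet → ZFSet` mapping `M` into `N`, elementary for all first-order formulas
with parameters from `M`. -/
structure ClassEmb (M N : Set ZFSet.{u}) where
  j : ZFSet.{u} → ZFSet.{u}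
  maps : ∀ x, x ∈ M → j x ∈ N
  elem : ∀ {n : ℕ} (φ : SetLang.Formula (Fin n)) (v : Fin n → ZFSet.{u}) (hv : ∀ i, v i ∈ M),
    φ.Realize (fun i => (⟨v i, hv i⟩ : M)) ↔ φ.Realize (fun i => (⟨j (v i), maps _ (hv i)⟩ : N))

/-- The universe of all ZF-sets, as a class. -/
def V : Set ZFSet.{u} := Set.univ

/-- A transitive class of ZF-sets. -/
def TransClass (M : Set ZFSet.{u}) : Prop := ∀ x ∈ M, ∀ y ∈ x, y ∈ M

/-- `j` has critical point `κ`: `κ` is an ordinal, fixed below `κ`, with `j(κ) > κ`. -/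
def CritPt (j : ZFSet.{u} → ZFSet.{u}) (κ : ZFSet.{u}) : Prop :=
  κ.IsOrdinal ∧ κ ∈ j κ ∧ ∀ α : ZFSet, α.IsOrdinal → α ∈ κ → j α = α

/-- `x` is a member of the rank-initial segment `V_θ`. -/
def MemV (θ x : ZFSet.{u}) : Prop := x.rank < θ.rank

/-- `κ` is a cardinal: an ordinal not equinumerous with any smaller ordinal. -/
def IsCard (κ : ZFSet.{u}) : Prop :=
  κ.IsOrdinal ∧ ∀ β ∈ κ, Cardinal.mk β.toSet < Cardinal.mk κ.toSet

/-- `x ∈ H(θ⁺)`, i.e. `x` has hereditary size at most `θ`. -/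
def MemH (θ x : ZFSet.{u}) : Prop :=
  ∃ t : ZFSet, t.IsTransitive ∧ x ∈ t ∧ Cardinal.mk t.toSet ≤ Cardinal.mk θ.toSet

/-- `f` is a set-function with domain `θ` taking values in the class `M`. -/
def IsFuncInto (θ : ZFSet.{u}) (M : Set ZFSet.{u}) (f : ZFSet.{u}) : Prop :=
  (∀ p ∈ f, ∃ a b : ZFSet, a ∈ θ ∧ b ∈ M ∧ p = ZFSet.pair a b) ∧
  ∀ a ∈ θ, ∃! b : ZFSet, ZFSet.pair a b ∈ f

/-- The class `M` is closed under `θ`-sequences: `M^θ ⊆ M`. -/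
def SeqClosed (θ : ZFSet.{u}) (M : Set ZFSet.{u}) : Prop :=
  ∀ f : ZFSet, IsFuncInto θ M f → f ∈ M

/-- The set `M` is closed under `<κ`-sequences: `M^{<κ} ⊆ M`. -/
def SeqClosedLt (κ M : ZFSet.{u}) : Prop :=
  ∀ α : ZFSet, α ∈ κ → ∀ f : ZFSet, IsFuncInto α M.toSet f → f ∈ M

/-- `ℓ` is a partial function from `κ` to `V_κ` (coded as a set of Kuratowski pairs). -/
def IsPFun (κ ℓ : ZFSet.{u}) : Prop :=
  (∀ p ∈ ℓ, ∃ γ A : ZFSet, γ ∈ κ ∧ MemV κ A ∧ p = ZFSet.pair γ A) ∧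
  ∀ γ A B : ZFSet, ZFSet.pair γ A ∈ ℓ → ZFSet.pair γ B ∈ ℓ → A = B

/-- The set `r` is the restriction to `κ` of the class function `ℓ` (defined on the
ordinals below `κ`), coded as a set of Kuratowski pairs. -/
def RestrictEq (ℓ : ZFSet.{u} → ZFSet.{u}) (κ r : ZFSet.{u}) : Prop :=
  ∀ p : ZFSet, p ∈ r ↔ ∃ γ : ZFSet, γ ∈ κ ∧ p = ZFSet.pair γ (ℓ γ)

/-- The set `r` is the restriction to `κ` of the class function `ℓ` restricted further to
the class `D`. -/
def RestrictEqOn (ℓ : ZFSet.{u} → ZFSet.{u}) (D : Set ZFSet.{u}) (κ r : ZFSet.{u}) : Prop :=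
  ∀ p : ZFSet, p ∈ r ↔ ∃ γ : ZFSet, γ ∈ κ ∧ γ ∈ D ∧ p = ZFSet.pair γ (ℓ γ)

/-- The set `r` is the restriction to `δ` of the set partial function `ℓ`. -/
def RestrictSet (ℓ δ r : ZFSet.{u}) : Prop :=
  ∀ p : ZFSet, p ∈ r ↔ p ∈ ℓ ∧ ∃ γ A : ZFSet, γ ∈ δ ∧ p = ZFSet.pair γ A

/-! ### Supercompactness -/

/-- A `θ`-supercompactness embedding with critical point `κ`: an elementary embedding
`j : V → M` with `M` a transitive class closed under `θ`-sequences and `j(κ) > θ`. -/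
structure SCEmb (κ θ : ZFSet.{u}) where
  M : Set ZFSet.{u}
  trans : TransClass M
  e : ClassEmb V M
  crit : CritPt e.j κ
  closed : SeqClosed θ M
  big : θ ∈ e.j κ

/-- `κ` is `θ`-supercompact. -/
def SCAt (κ θ : ZFSet.{u}) : Prop := Nonempty (SCEmb κ θ)

/-- `κ` is supercompact: `θ`-supercompact for every cardinal `θ`. -/
def Supercompact (κ : ZFSet.{u}) : Prop := ∀ θ : ZFSet, IsCard θ → SCAt κ θ

/-- `ℓ` is a Laver function witnessing the Laver diamond `LD^sc_κ`. -/
def LDscFun (κ ℓ : ZFSet.{u}) : Prop :=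
  IsPFun κ ℓ ∧ ∀ θ A : ZFSet, IsCard θ → MemH θ A →
    ∃ E : SCEmb κ θ, ZFSet.pair κ A ∈ E.e.j ℓ

/-- The Laver diamond principle `LD^sc_κ`. -/
def LDsc (κ : ZFSet.{u}) : Prop := ∃ ℓ : ZFSet, LDscFun κ ℓ

/-- A universal `LD^sc` Laver function. -/
def UnivLDsc (ℓ : ZFSet.{u} → ZFSet.{u}) : Prop :=
  ∀ κ : ZFSet, Supercompact κ → ∃ r : ZFSet, RestrictEq ℓ κ r ∧ LDscFun κ r

/-! ### Strongness -/

/-- A `θ`-strongness embedding with critical point `κ`: an elementary `j : V → M` with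
`M` a transitive class and `V_θ ⊆ M`. -/
structure StrEmb (κ θ : ZFSet.{u}) where
  M : Set ZFSet.{u}
  trans : TransClass M
  e : ClassEmb V M
  crit : CritPt e.j κ
  vsub : ∀ x : ZFSet, MemV θ x → x ∈ M

/-- `κ` is `θ`-strong. -/
def StrongAt (κ θ : ZFSet.{u}) : Prop := Nonempty (StrEmb κ θ)

/-- `κ` is a strong cardinal. -/
def Strong (κ : ZFSet.{u}) : Prop := ∀ θ : ZFSet, θ.IsOrdinal → StrongAt κ θ

/-- `ℓ` witnesses the Laver diamond `LD^strong_κ`. -/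
def LDstrongFun (κ ℓ : ZFSet.{u}) : Prop :=
  IsPFun κ ℓ ∧ ∀ θ A : ZFSet, θ.IsOrdinal → MemV θ A →
    ∃ E : StrEmb κ θ, ZFSet.pair κ A ∈ E.e.j ℓ

/-- The Laver diamond principle `LD^strong_κ`. -/
def LDstrong (κ : ZFSet.{u}) : Prop := ∃ ℓ : ZFSet, LDstrongFun κ ℓ

/-- A universal `LD^strong` Laver function. -/
def UnivLDstrong (ℓ : ZFSet.{u} → ZFSet.{u}) : Prop :=
  ∀ κ : ZFSet, Strong κ → ∃ r : ZFSet, RestrictEq ℓ κ r ∧ LDstrongFun κ r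

/-! ### Measurability -/

/-- An embedding witnessing measurability of `κ`: an elementary `j : V → M`
with `M` a transitive class and critical point `κ`. -/
structure MeasEmb (κ : ZFSet.{u}) where
  M : Set ZFSet.{u}
  trans : TransClass M
  e : ClassEmb V M
  crit : CritPt e.j κ

/-- `κ` is a measurable cardinal. -/
def MeasurableCard (κ : ZFSet.{u}) : Prop := Nonempty (MeasEmb κ)

/-- `ℓ` witnesses the Laver diamond `LD^meas_κ`. -/
def LDmeasFun (κ ℓ : ZFSet.{u}) : Prop :=
  IsPFun κ ℓ ∧ ∀ A : ZFSet, MemH κ A → ∃ E : MeasEmb κ, ZFSet.pair κ A ∈ E.e.j ℓ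

/-- The Laver diamond principle `LD^meas_κ`. -/
def LDmeas (κ : ZFSet.{u}) : Prop := ∃ ℓ : ZFSet, LDmeasFun κ ℓ

/-- A universal `LD^meas` Laver function. -/
def UnivLDmeas (ℓ : ZFSet.{u} → ZFSet.{u}) : Prop :=
  ∀ κ : ZFSet, MeasurableCard κ → ∃ r : ZFSet, RestrictEq ℓ κ r ∧ LDmeasFun κ r

/-! ### Weak compactness -/

/-- `κ` is weakly compact: every transitive set `M` of size `κ` with `κ ∈ M` admits an
elementary embedding `j : M → N` into a transitive set `N` with critical point `κ`. -/
def WeaklyCompact (κ : ZFSet.{u}) : Prop :=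
  ∀ M : ZFSet, M.IsTransitive → Cardinal.mk M.toSet = Cardinal.mk κ.toSet → κ ∈ M →
    ∃ N : ZFSet, N.IsTransitive ∧ ∃ e : ClassEmb M.toSet N.toSet, CritPt e.j κ

/-- `ℓ` witnesses the Laver diamond `LD^wc_κ`. -/
def LDwcFun (κ ℓ : ZFSet.{u}) : Prop :=
  IsPFun κ ℓ ∧ ∀ A M : ZFSet, MemH κ A →
    M.IsTransitive → Cardinal.mk M.toSet = Cardinal.mk κ.toSet → κ ∈ M → A ∈ M → ℓ ∈ M →
    ∃ N : ZFSet, N.IsTransitive ∧ ∃ e : ClassEmb M.toSet N.toSet,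
      CritPt e.j κ ∧ ZFSet.pair κ A ∈ e.j ℓ

/-- The Laver diamond principle `LD^wc_κ`. -/
def LDwc (κ : ZFSet.{u}) : Prop := ∃ ℓ : ZFSet, LDwcFun κ ℓ

/-- A universal `LD^wc` Laver function. -/
def UnivLDwc (ℓ : ZFSet.{u} → ZFSet.{u}) : Prop :=
  ∀ κ : ZFSet, WeaklyCompact κ → ∃ r : ZFSet, RestrictEq ℓ κ r ∧ LDwcFun κ r

/-! ### Nice structures and unfoldability -/

/-- `M` is a nice structure for `κ`: a transitive set of size `κ`, closed under
`<κ`-sequences, with `κ ∈ M`. -/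
def Nice (κ M : ZFSet.{u}) : Prop :=
  M.IsTransitive ∧ Cardinal.mk M.toSet = Cardinal.mk κ.toSet ∧ SeqClosedLt κ M ∧ κ ∈ M

/-- `κ` is unfoldable: for every ordinal `θ`, every nice structure admits a
`θ`-unfoldability embedding. -/
def Unfoldable (κ : ZFSet.{u}) : Prop :=
  ∀ θ M : ZFSet, θ.IsOrdinal → Nice κ M →
    ∃ N : ZFSet, N.IsTransitive ∧ ∃ e : ClassEmb M.toSet N.toSet, CritPt e.j κ ∧ θ ∈ e.j κ

/-- `ℓ` witnesses the Laver diamond `LD^unf_κ`. -/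
def LDunfFun (κ ℓ : ZFSet.{u}) : Prop :=
  IsPFun κ ℓ ∧ ∀ θ A M : ZFSet, θ.IsOrdinal → MemH κ A →
    M.IsTransitive → Cardinal.mk M.toSet = Cardinal.mk κ.toSet → SeqClosedLt κ M →
    κ ∈ M → ℓ ∈ M → A ∈ M →
    ∃ N : ZFSet, N.IsTransitive ∧ ∃ e : ClassEmb M.toSet N.toSet,
      CritPt e.j κ ∧ θ ∈ e.j κ ∧ ZFSet.pair κ A ∈ e.j ℓ

/-- The Laver diamond principle `LD^unf_κ`. -/
def LDunf (κ : ZFSet.{u}) : Prop := ∃ ℓ : ZFSet, LDunfFun κ ℓ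

/-- `ℓ` witnesses the Laver diamond `LD^sunf_κ` for strong unfoldability. -/
def LDsunfFun (κ ℓ : ZFSet.{u}) : Prop :=
  IsPFun κ ℓ ∧ ∀ θ A M : ZFSet, IsCard θ → MemH θ A →
    M.IsTransitive → Cardinal.mk M.toSet = Cardinal.mk κ.toSet → SeqClosedLt κ M →
    κ ∈ M → ℓ ∈ M →
    ∃ N : ZFSet, N.IsTransitive ∧ (∀ x : ZFSet, MemV θ x → x ∈ N) ∧
      ∃ e : ClassEmb M.toSet N.toSet, CritPt e.j κ ∧ θ ∈ e.j κ ∧ ZFSet.pair κ A ∈ e.j ℓ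

/-! ### Ramsey cardinals -/

/-- `F` is a weakly amenable `M`-normal measure on `κ`. -/
def MNormalMeasure (κ M F : ZFSet.{u}) : Prop :=
  (∀ X ∈ F, X ⊆ κ ∧ X ∈ M) ∧ κ ∈ F ∧ (∅ : ZFSet) ∉ F ∧
  (∀ X Y : ZFSet, X ∈ F → Y ∈ F → X ∩ Y ∈ F) ∧
  (∀ X Y : ZFSet, X ∈ F → Y ∈ M → X ⊆ Y → Y ⊆ κ → Y ∈ F) ∧
  (∀ X : ZFSet, X ∈ M → X ⊆ κ → (X ∈ F ∨ κ \ X ∈ F)) ∧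
  (∀ ξ ∈ κ, ({ξ} : ZFSet) ∉ F) ∧
  (∀ γ f : ZFSet, γ ∈ κ → f ∈ M → IsFuncInto γ F.toSet f →
    ZFSet.sep (fun ξ => ∀ a X : ZFSet, ZFSet.pair a X ∈ f → ξ ∈ X) κ ∈ F) ∧
  (∀ f : ZFSet, f ∈ M → IsFuncInto κ F.toSet f →
    ZFSet.sep (fun ξ => ∀ a X : ZFSet, ZFSet.pair a X ∈ f → a ∈ ξ → ξ ∈ X) κ ∈ F) ∧
  (∀ D : ZFSet, D ∈ M → MemH κ D → F ∩ D ∈ M)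

/-- `j` is (isomorphic to) the ultrapower map of `M` by the `M`-measure `F` on `κ`, with
transitive (wellfounded) target `N`: `j` is elementary, has critical point `κ`, derives the
measure `F` at `κ`, and every element of `N` has the form `j(f)(κ)` for some function
`f ∈ M` with domain `κ`. -/
def IsUltrapowerMap (κ M F N : ZFSet.{u}) (j : ZFSet.{u} → ZFSet.{u}) : Prop :=
  N.IsTransitive ∧ (∃ e : ClassEmb M.toSet N.toSet, e.j = j) ∧ CritPt j κ ∧
  (∀ X : ZFSet, X ∈ M → X ⊆ κ → (X ∈ F ↔ κ ∈ j X)) ∧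
  (∀ y ∈ N, ∃ f : ZFSet, f ∈ M ∧ (∀ a ∈ κ, ∃! b : ZFSet, ZFSet.pair a b ∈ f) ∧
    ZFSet.pair κ y ∈ j f)

/-- A wellfounded iteration of `⟨M, F⟩` of length `δ`: a commuting system of elementary
embeddings between transitive models, starting at `⟨M, F⟩`, taking ultrapowers by the
image measures at successor steps and direct limits at limit stages. -/
structure Iteration (κ M F δ : ZFSet.{u}) where
  Mod : ZFSet.{u} → ZFSet.{u}
  Meas : ZFSet.{u} → ZFSet.{u}
  cp : ZFSet.{u} → ZFSet.{u}
  emb : ZFSet.{u} → ZFSet.{u} → ZFSet.{u} → ZFSet.{u}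
  mod_zero : Mod ∅ = M
  meas_zero : Meas ∅ = F
  cp_zero : cp ∅ = κ
  trans' : ∀ i : ZFSet, i ∈ δ → (Mod i).IsTransitive
  elem' : ∀ i k : ZFSet, i ∈ δ → k ∈ δ → i ∈ k →
    ∃ e : ClassEmb (Mod i).toSet (Mod k).toSet, e.j = emb i k
  comm : ∀ i k l : ZFSet, i ∈ δ → k ∈ δ → l ∈ δ → i ∈ k → k ∈ l →
    ∀ x ∈ Mod i, emb k l (emb i k x) = emb i l x
  cp_emb : ∀ i : ZFSet, i ∈ δ → i ≠ ∅ → cp i = emb ∅ i κ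
  succ' : ∀ i : ZFSet, i ∈ δ → insert i i ∈ δ →
    IsUltrapowerMap (cp i) (Mod i) (Meas i) (Mod (insert i i)) (emb i (insert i i)) ∧
    (∀ Y : ZFSet, Y ∈ Meas (insert i i) ↔
      ∃ D : ZFSet, D ∈ Mod i ∧ Y ∈ emb i (insert i i) (Meas i ∩ D))
  limit' : ∀ l : ZFSet, l ∈ δ → l ≠ ∅ → (∀ i ∈ l, insert i i ∈ l) →
    (∀ y ∈ Mod l, ∃ i : ZFSet, i ∈ l ∧ ∃ x, x ∈ Mod i ∧ emb i l x = y) ∧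
    (∀ Y : ZFSet, Y ∈ Meas l ↔
      ∃ i : ZFSet, i ∈ l ∧ ∃ D, D ∈ Mod i ∧ Y ∈ emb i l (Meas i ∩ D))

/-- `⟨M, F⟩` is iterable: all its iterations (of any ordinal length) are wellfounded,
i.e. realized by transitive models. -/
def Iterable (κ M F : ZFSet.{u}) : Prop :=
  ∀ δ : ZFSet, δ.IsOrdinal → Nonempty (Iteration κ M F δ)

/-! ### Constructibility -/

/-- `X` is a subset of `M` definable over `⟨M, ∈⟩` with parameters. -/
def DefinableSubset (M X : ZFSet.{u}) : Prop :=
  X ⊆ M ∧ ∃ (n : ℕ) (φ : SetLang.Formula (Fin (n + 1))) (v : Fin n → ZFSet.{u})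
    (hv : ∀ i, v i ∈ M.toSet),
    ∀ a : ZFSet, a ∈ X ↔ ∃ ha : a ∈ M.toSet,
      φ.Realize (Fin.cons (⟨a, ha⟩ : M.toSet) (fun i => (⟨v i, hv i⟩ : M.toSet)))

/-- The set of all subsets of `M` definable over `⟨M, ∈⟩` with parameters. -/
noncomputable def DefSet (M : ZFSet.{u}) : ZFSet.{u} :=
  ZFSet.sep (fun X => DefinableSubset M X) (ZFSet.powerset M)

/-- `h` codes the constructible hierarchy up to `δ`: a function with domain `δ` such that
`h(β) = ⋃_{γ<β} Def(h(γ))` for every `β < δ`. -/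
def IsLHierarchy (δ h : ZFSet.{u}) : Prop :=
  δ.IsOrdinal ∧
  (∀ p ∈ h, ∃ β y : ZFSet, β ∈ δ ∧ p = ZFSet.pair β y) ∧
  (∀ β ∈ δ, ∃! y : ZFSet, ZFSet.pair β y ∈ h) ∧
  ∀ β y : ZFSet, ZFSet.pair β y ∈ h →
    ∀ z : ZFSet, z ∈ y ↔ ∃ γ x : ZFSet, γ ∈ β ∧ ZFSet.pair γ x ∈ h ∧ z ∈ DefSet x

/-- `x` is constructible: it appears at some level of some constructible hierarchy. -/
def Constructible (x : ZFSet.{u}) : Prop :=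
  ∃ δ h β y : ZFSet, IsLHierarchy δ h ∧ ZFSet.pair β y ∈ h ∧ x ∈ y

/-- The axiom of constructibility `V = L`. -/
def VeqL : Prop := ∀ x : ZFSet.{u}, Constructible x

/-! ### Normal measures -/

/-- `U` is a normal measure on `κ`: a `κ`-complete nonprincipal ultrafilter on `κ`
closed under diagonal intersections. -/
def IsNormalMeasure (κ U : ZFSet.{u}) : Prop :=
  (∀ X ∈ U, X ⊆ κ) ∧ κ ∈ U ∧ (∅ : ZFSet) ∉ U ∧
  (∀ X Y : ZFSet, X ∈ U → Y ∈ U → X ∩ Y ∈ U) ∧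
  (∀ X Y : ZFSet, X ∈ U → X ⊆ Y → Y ⊆ κ → Y ∈ U) ∧
  (∀ X : ZFSet, X ⊆ κ → (X ∈ U ∨ κ \ X ∈ U)) ∧
  (∀ ξ ∈ κ, ({ξ} : ZFSet) ∉ U) ∧
  (∀ γ f : ZFSet, γ ∈ κ → IsFuncInto γ U.toSet f →
    ZFSet.sep (fun ξ => ∀ a X : ZFSet, ZFSet.pair a X ∈ f → ξ ∈ X) κ ∈ U) ∧
  (∀ f : ZFSet, IsFuncInto κ U.toSet f →
    ZFSet.sep (fun ξ => ∀ a X : ZFSet, ZFSet.pair a X ∈ f → a ∈ ξ → ξ ∈ X) κ ∈ U)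

end LaverDiamond

namespace LaverDiamond

open Filter

/-- The atomic formula `x ∈ y`. -/
def memF {α : Type*} (x y : α) : SetLang.Formula α :=
  Language.Relations.formula₂ (memRel.mem : SetLang.Relations 2) (.var x) (.var y)

/-- The atomic formula `x = y`. -/
def eqF {α : Type*} (x y : α) : SetLang.Formula α :=
  Language.Term.equal (.var x) (.var y)

/-- Universal quantification over the named variable `i`. -/
def allF (i : ℕ) (φ : SetLang.Formula ℕ) : SetLang.Formula ℕ :=
  Language.BoundedFormula.all (n := 0)
    (Language.BoundedFormula.relabel (n := 1) (k := 0)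
      (fun k : ℕ => if k = i then Sum.inr (0 : Fin 1) else Sum.inl k) φ)

/-- Existential quantification over the named variable `i`. -/
def exF (i : ℕ) (φ : SetLang.Formula ℕ) : SetLang.Formula ℕ := (allF i φ.not).not

/-- A formula saying that `p` is the ordered pair of `a` and `b`, for variables below `20`. -/
def pairF (p a b : ℕ) : SetLang.Formula ℕ :=
  exF 20 (exF 21 ((memF 20 p ⊓ memF 21 p) ⊓
    (allF 22 ((memF 22 p).imp (eqF 22 20 ⊔ eqF 22 21)) ⊓
      (allF 22 ((memF 22 20).iff (eqF 22 a)) ⊓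
        allF 22 ((memF 22 21).iff (eqF 22 a ⊔ eqF 22 b))))))

section Realize

variable {N : Set ZFSet.{u}}

@[simp]
theorem realize_memF {α : Type*} {x y : α} {e : α → N} :
    (memF x y).Realize e ↔ (e x : ZFSet) ∈ (e y : ZFSet) := by
  exact Language.Formula.realize_rel₂.trans Iff.rfl

@[simp]
theorem realize_eqF {α : Type*} {x y : α} {e : α → N} :
    (eqF x y).Realize e ↔ (e x : ZFSet) = (e y : ZFSet) := by
  rw [eqF, Language.Formula.realize_equal]
  exact Subtype.ext_iff

@[simp]
theorem realize_allF {i : ℕ} {φ : SetLang.Formula ℕ} {e : ℕ → N} :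
    (allF i φ).Realize e ↔ ∀ x : N, φ.Realize (Function.update e i x) := by
  rw [allF, Language.Formula.Realize, Language.BoundedFormula.realize_all]
  refine forall_congr' fun x => ?_
  rw [Language.BoundedFormula.realize_relabel, Language.Formula.Realize]
  apply iff_of_eq
  congr 1
  · funext k
    by_cases hk : k = i
    · subst hk
      simp [Fin.snoc]
    · simp [hk]
  · exact Subsingleton.elim _ _

@[simp]
theorem realize_exF {i : ℕ} {φ : SetLang.Formula ℕ} {e : ℕ → N} :
    (exF i φ).Realize e ↔ ∃ x : N, φ.Realize (Function.update e i x) := by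
  simp [exF]

theorem realize_pairF (hN : TransClass N) {p a b : ℕ} (hp : p < 20) (ha : a < 20) (hb : b < 20)
    {e : ℕ → N} :
    (pairF p a b).Realize e ↔ (e p : ZFSet) = ZFSet.pair (e a) (e b) := by
  have h1 : p ≠ 20 ∧ p ≠ 21 ∧ p ≠ 22 := by omega
  have h2 : a ≠ 20 ∧ a ≠ 21 ∧ a ≠ 22 := by omega
  have h3 : b ≠ 20 ∧ b ≠ 21 ∧ b ≠ 22 := by omega
  simp only [pairF, realize_exF, Language.Formula.realize_inf, Language.Formula.realize_sup,
    Language.Formula.realize_imp, Language.Formula.realize_iff, realize_allF, realize_memF,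
    realize_eqF, Function.update_apply, h1, h2, h3, if_false, if_true, Nat.reduceEqDiff]
  constructor
  · rintro ⟨s, d, ⟨hs, hd⟩, hz, hs', hd'⟩
    have es : (s : ZFSet) = {(e a : ZFSet)} := by
      ext w
      rw [ZFSet.mem_singleton]
      constructor
      · intro hw
        exact (hs' ⟨w, hN _ s.2 _ hw⟩).1 hw
      · rintro rfl
        exact (hs' (e a)).2 rfl
    have ed : (d : ZFSet) = {(e a : ZFSet), (e b : ZFSet)} := by
      ext w
      rw [ZFSet.mem_pair]
      constructor
      · intro hw
        exact (hd' ⟨w, hN _ d.2 _ hw⟩).1 hw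
      · rintro (rfl | rfl)
        · exact (hd' (e a)).2 (Or.inl rfl)
        · exact (hd' (e b)).2 (Or.inr rfl)
    ext z
    rw [ZFSet.pair, ZFSet.mem_pair, ← es, ← ed]
    constructor
    · intro hz'
      exact hz ⟨z, hN _ (e p).2 _ hz'⟩ hz'
    · rintro (rfl | rfl)
      · exact hs
      · exact hd
  · intro h
    have hs : ({(e a : ZFSet)} : ZFSet) ∈ (e p : ZFSet) := by
      rw [h, ZFSet.pair, ZFSet.mem_pair]; exact Or.inl rfl
    have hd : ({(e a : ZFSet), (e b : ZFSet)} : ZFSet) ∈ (e p : ZFSet) := by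
      rw [h, ZFSet.pair, ZFSet.mem_pair]; exact Or.inr rfl
    refine ⟨⟨_, hN _ (e p).2 _ hs⟩, ⟨_, hN _ (e p).2 _ hd⟩, ⟨hs, hd⟩, ?_, ?_, ?_⟩
    · intro x hx
      rw [h, ZFSet.pair, ZFSet.mem_pair] at hx
      exact hx
    · intro x
      exact ZFSet.mem_singleton
    · intro x
      exact ZFSet.mem_pair

end Realize

theorem transClass_V : TransClass V.{u} := fun _ _ _ _ => trivial

/-- The assignment giving the variables `0`, `1`, `2` the values `X`, `Y`, `Z`. -/
def params (X Y Z : ZFSet.{u}) (i : ℕ) : ZFSet.{u} := if i = 0 then X else if i = 1 then Y else Z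

/-- Elementarity for formulas in named variables, of which three carry parameters. -/
theorem ClassEmb.transfer {M : Set ZFSet.{u}} (E : ClassEmb V M) (φ : SetLang.Formula ℕ)
    (X Y Z : ZFSet.{u})
    (h : φ.Realize (fun i : ℕ => (⟨params X Y Z i, trivial⟩ : V.{u}))) :
    φ.Realize (fun i : ℕ => (⟨params (E.j X) (E.j Y) (E.j Z) i, by
      unfold params; split_ifs <;> exact E.maps _ trivial⟩ : M)) := by
  have := E.elem (φ.relabel (fun i : ℕ => if i = 0 then (0 : Fin 3) else if i = 1 then 1 else 2))
    ![X, Y, Z] (fun _ => trivial)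
  rw [Language.Formula.realize_relabel, Language.Formula.realize_relabel] at this
  have e := this.1 (by
    convert h using 2 with i
    simp only [Function.comp, params]
    split_ifs <;> rfl)
  convert e using 2 with i
  simp only [Function.comp, params]
  split_ifs <;> rfl

section Transfer

set_option linter.unusedSimpArgs false

namespace MeasEmb

variable {κ : ZFSet.{u}} (E : MeasEmb κ)

theorem mem_of_mem {X z : ZFSet.{u}} (h : z ∈ E.e.j X) : z ∈ E.M :=
  E.trans _ (E.e.maps _ trivial) _ h

theorem mem_of_pair_mem {X a b : ZFSet.{u}} (h : ZFSet.pair a b ∈ E.e.j X) : a ∈ E.M ∧ b ∈ E.M := by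
  have hs := E.trans _ (E.mem_of_mem h) {a, b} (by simp [ZFSet.pair])
  exact ⟨E.trans _ hs _ (by simp), E.trans _ hs _ (by simp)⟩

theorem forall_not {X Y : ZFSet.{u}}
    (h : ∀ z ∈ X, z ∉ Y) :
    ∀ z ∈ E.e.j X, z ∉ E.e.j Y := by
  have := E.e.transfer (allF 10 ((memF 10 0).imp (memF 10 1).not)) X Y ∅
    (by
      simp only [Language.Formula.realize_inf, Language.Formula.realize_sup,
        Language.Formula.realize_imp, Language.Formula.realize_not, realize_exF, realize_allF,
        realize_memF, realize_eqF, Function.update_apply, Nat.reduceEqDiff, if_true, if_false,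
        params, realize_pairF transClass_V, Nat.reduceLT]
      exact fun z => h z)
  simp only [Language.Formula.realize_inf, Language.Formula.realize_sup,
    Language.Formula.realize_imp, Language.Formula.realize_not, realize_exF, realize_allF,
    realize_memF, realize_eqF, Function.update_apply, Nat.reduceEqDiff, if_true, if_false, params,
    realize_pairF E.trans, Nat.reduceLT] at this
  exact fun z hz => this ⟨z, E.mem_of_mem hz⟩ hz

theorem forall_mem_imp {α X Y : ZFSet.{u}}
    (h : ∀ z ∈ X, α ∈ z → z ∈ Y) :
    ∀ z ∈ E.e.j X, E.e.j α ∈ z → z ∈ E.e.j Y := by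
  have := E.e.transfer (allF 10 ((memF 10 1).imp ((memF 0 10).imp (memF 10 2)))) α X Y
    (by
      simp only [Language.Formula.realize_inf, Language.Formula.realize_sup,
        Language.Formula.realize_imp, Language.Formula.realize_not, realize_exF, realize_allF,
        realize_memF, realize_eqF, Function.update_apply, Nat.reduceEqDiff, if_true, if_false,
        params, realize_pairF transClass_V, Nat.reduceLT]
      exact fun z => h z)
  simp only [Language.Formula.realize_inf, Language.Formula.realize_sup,
    Language.Formula.realize_imp, Language.Formula.realize_not, realize_exF, realize_allF,
    realize_memF, realize_eqF, Function.update_apply, Nat.reduceEqDiff, if_true, if_false, params,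
    realize_pairF E.trans, Nat.reduceLT] at this
  exact fun z hz => this ⟨z, E.mem_of_mem hz⟩ hz

theorem forall_or {X Y Z : ZFSet.{u}}
    (h : ∀ z ∈ X, z ∈ Y ∨ z ∈ Z) :
    ∀ z ∈ E.e.j X, z ∈ E.e.j Y ∨ z ∈ E.e.j Z := by
  have := E.e.transfer (allF 10 ((memF 10 0).imp (memF 10 1 ⊔ memF 10 2))) X Y Z
    (by
      simp only [Language.Formula.realize_inf, Language.Formula.realize_sup,
        Language.Formula.realize_imp, Language.Formula.realize_not, realize_exF, realize_allF,
        realize_memF, realize_eqF, Function.update_apply, Nat.reduceEqDiff, if_true, if_false,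
        params, realize_pairF transClass_V, Nat.reduceLT]
      exact fun z => h z)
  simp only [Language.Formula.realize_inf, Language.Formula.realize_sup,
    Language.Formula.realize_imp, Language.Formula.realize_not, realize_exF, realize_allF,
    realize_memF, realize_eqF, Function.update_apply, Nat.reduceEqDiff, if_true, if_false, params,
    realize_pairF E.trans, Nat.reduceLT] at this
  exact fun z hz => this ⟨z, E.mem_of_mem hz⟩ hz

theorem forall_imp {X Y Z : ZFSet.{u}}
    (h : ∀ z ∈ X, z ∈ Y → z ∈ Z) :
    ∀ z ∈ E.e.j X, z ∈ E.e.j Y → z ∈ E.e.j Z := by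
  have := E.e.transfer (allF 10 ((memF 10 0).imp ((memF 10 1).imp (memF 10 2)))) X Y Z
    (by
      simp only [Language.Formula.realize_inf, Language.Formula.realize_sup,
        Language.Formula.realize_imp, Language.Formula.realize_not, realize_exF, realize_allF,
        realize_memF, realize_eqF, Function.update_apply, Nat.reduceEqDiff, if_true, if_false,
        params, realize_pairF transClass_V, Nat.reduceLT]
      exact fun z => h z)
  simp only [Language.Formula.realize_inf, Language.Formula.realize_sup,
    Language.Formula.realize_imp, Language.Formula.realize_not, realize_exF, realize_allF,
    realize_memF, realize_eqF, Function.update_apply, Nat.reduceEqDiff, if_true, if_false, params,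
    realize_pairF E.trans, Nat.reduceLT] at this
  exact fun z hz => this ⟨z, E.mem_of_mem hz⟩ hz

theorem forall_pair_notMem {α X F : ZFSet.{u}}
    (h : ∀ z ∈ X, ZFSet.pair α z ∉ F) :
    ∀ z ∈ E.e.j X, ZFSet.pair (E.e.j α) z ∉ E.e.j F := by
  have := E.e.transfer (allF 10 ((memF 10 1).imp (allF 11 ((memF 11 2).imp (pairF 11 0 10).not)))) α X F
    (by
      simp only [Language.Formula.realize_inf, Language.Formula.realize_sup,
        Language.Formula.realize_imp, Language.Formula.realize_not, realize_exF, realize_allF,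
        realize_memF, realize_eqF, Function.update_apply, Nat.reduceEqDiff, if_true, if_false,
        params, realize_pairF transClass_V, Nat.reduceLT]
      rintro z hz p hp e
      exact h z hz (e ▸ hp))
  simp only [Language.Formula.realize_inf, Language.Formula.realize_sup,
    Language.Formula.realize_imp, Language.Formula.realize_not, realize_exF, realize_allF,
    realize_memF, realize_eqF, Function.update_apply, Nat.reduceEqDiff, if_true, if_false, params,
    realize_pairF E.trans, Nat.reduceLT] at this
  exact fun z hz hp => this ⟨z, E.mem_of_mem hz⟩ hz ⟨_, E.mem_of_mem hp⟩ hp rfl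

theorem forall_or_exists_pair {X Y F : ZFSet.{u}}
    (h : ∀ z ∈ X, z ∈ Y ∨ ∃ a ∈ z, ZFSet.pair a z ∈ F) :
    ∀ z ∈ E.e.j X, z ∈ E.e.j Y ∨ ∃ a ∈ z, ZFSet.pair a z ∈ E.e.j F := by
  have := E.e.transfer (allF 10 ((memF 10 0).imp ((memF 10 1) ⊔
    exF 11 (memF 11 10 ⊓ exF 12 (memF 12 2 ⊓ pairF 12 11 10))))) X Y F
    (by
      simp only [Language.Formula.realize_inf, Language.Formula.realize_sup,
        Language.Formula.realize_imp, Language.Formula.realize_not, realize_exF, realize_allF,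
        realize_memF, realize_eqF, Function.update_apply, Nat.reduceEqDiff, if_true, if_false,
        params, realize_pairF transClass_V, Nat.reduceLT]
      intro z hz
      rcases h z hz with h | ⟨a, ha, hp⟩
      · exact Or.inl h
      · exact Or.inr ⟨⟨a, trivial⟩, ha, ⟨_, trivial⟩, hp, rfl⟩)
  simp only [Language.Formula.realize_inf, Language.Formula.realize_sup,
    Language.Formula.realize_imp, Language.Formula.realize_not, realize_exF, realize_allF,
    realize_memF, realize_eqF, Function.update_apply, Nat.reduceEqDiff, if_true, if_false, params,
    realize_pairF E.trans, Nat.reduceLT] at this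
  intro z hz
  rcases this ⟨z, E.mem_of_mem hz⟩ hz with h | ⟨a, ha, p, hp, e⟩
  · exact Or.inl h
  · exact Or.inr ⟨a, ha, e ▸ hp⟩

theorem exists_pair {X F : ZFSet.{u}}
    (h : ∀ z ∈ X, ∃ c, ZFSet.pair z c ∈ F) :
    ∀ z ∈ E.e.j X, ∃ c, ZFSet.pair z c ∈ E.e.j F := by
  have := E.e.transfer (allF 10 ((memF 10 0).imp (exF 11 (exF 12 (memF 12 1 ⊓ pairF 12 10 11))))) X F ∅
    (by
      simp only [Language.Formula.realize_inf, Language.Formula.realize_sup,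
        Language.Formula.realize_imp, Language.Formula.realize_not, realize_exF, realize_allF,
        realize_memF, realize_eqF, Function.update_apply, Nat.reduceEqDiff, if_true, if_false,
        params, realize_pairF transClass_V, Nat.reduceLT]
      intro z hz
      obtain ⟨c, hc⟩ := h z hz
      exact ⟨⟨c, trivial⟩, ⟨_, trivial⟩, hc, rfl⟩)
  simp only [Language.Formula.realize_inf, Language.Formula.realize_sup,
    Language.Formula.realize_imp, Language.Formula.realize_not, realize_exF, realize_allF,
    realize_memF, realize_eqF, Function.update_apply, Nat.reduceEqDiff, if_true, if_false, params,
    realize_pairF E.trans, Nat.reduceLT] at this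
  intro z hz
  obtain ⟨c, p, hp, e⟩ := this ⟨z, E.mem_of_mem hz⟩ hz
  exact ⟨c, e ▸ hp⟩

theorem pair_imp_eq {F G : ZFSet.{u}}
    (h : ∀ z c d, ZFSet.pair z c ∈ F → ZFSet.pair z d ∈ G → c = d) :
    ∀ z c d, ZFSet.pair z c ∈ E.e.j F → ZFSet.pair z d ∈ E.e.j G → c = d := by
  have := E.e.transfer (allF 10 (allF 11 (allF 12 (allF 13 (allF 14 ((pairF 13 10 11).imp
    ((pairF 14 10 12).imp ((memF 13 0).imp ((memF 14 1).imp (eqF 11 12)))))))))) F G ∅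
    (by
      simp only [Language.Formula.realize_inf, Language.Formula.realize_sup,
        Language.Formula.realize_imp, Language.Formula.realize_not, realize_exF, realize_allF,
        realize_memF, realize_eqF, Function.update_apply, Nat.reduceEqDiff, if_true, if_false,
        params, realize_pairF transClass_V, Nat.reduceLT]
      rintro z c d p q ep eq hp hq
      exact h z c d (ep ▸ hp) (eq ▸ hq))
  simp only [Language.Formula.realize_inf, Language.Formula.realize_sup,
    Language.Formula.realize_imp, Language.Formula.realize_not, realize_exF, realize_allF,
    realize_memF, realize_eqF, Function.update_apply, Nat.reduceEqDiff, if_true, if_false, params,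
    realize_pairF E.trans, Nat.reduceLT] at this
  intro z c d hF hG
  exact this ⟨z, (E.mem_of_pair_mem hF).1⟩ ⟨c, (E.mem_of_pair_mem hF).2⟩
    ⟨d, (E.mem_of_pair_mem hG).2⟩ ⟨_, E.mem_of_mem hF⟩ ⟨_, E.mem_of_mem hG⟩ rfl rfl hF hG

theorem pair_imp_mem {F G : ZFSet.{u}}
    (h : ∀ z c d, ZFSet.pair z c ∈ F → ZFSet.pair z d ∈ G → c ∈ d) :
    ∀ z c d, ZFSet.pair z c ∈ E.e.j F → ZFSet.pair z d ∈ E.e.j G → c ∈ d := by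
  have := E.e.transfer (allF 10 (allF 11 (allF 12 (allF 13 (allF 14 ((pairF 13 10 11).imp
    ((pairF 14 10 12).imp ((memF 13 0).imp ((memF 14 1).imp (memF 11 12)))))))))) F G ∅
    (by
      simp only [Language.Formula.realize_inf, Language.Formula.realize_sup,
        Language.Formula.realize_imp, Language.Formula.realize_not, realize_exF, realize_allF,
        realize_memF, realize_eqF, Function.update_apply, Nat.reduceEqDiff, if_true, if_false,
        params, realize_pairF transClass_V, Nat.reduceLT]
      rintro z c d p q ep eq hp hq
      exact h z c d (ep ▸ hp) (eq ▸ hq))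
  simp only [Language.Formula.realize_inf, Language.Formula.realize_sup,
    Language.Formula.realize_imp, Language.Formula.realize_not, realize_exF, realize_allF,
    realize_memF, realize_eqF, Function.update_apply, Nat.reduceEqDiff, if_true, if_false, params,
    realize_pairF E.trans, Nat.reduceLT] at this
  intro z c d hF hG
  exact this ⟨z, (E.mem_of_pair_mem hF).1⟩ ⟨c, (E.mem_of_pair_mem hF).2⟩
    ⟨d, (E.mem_of_pair_mem hG).2⟩ ⟨_, E.mem_of_mem hF⟩ ⟨_, E.mem_of_mem hG⟩ rfl rfl hF hG

theorem pair_pair_imp {F G X : ZFSet.{u}}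
    (h : ∀ z c, ZFSet.pair z c ∈ F → ZFSet.pair z c ∈ G → z ∈ X) :
    ∀ z c, ZFSet.pair z c ∈ E.e.j F → ZFSet.pair z c ∈ E.e.j G → z ∈ E.e.j X := by
  have := E.e.transfer (allF 10 (allF 11 (allF 12 ((pairF 12 10 11).imp
    ((memF 12 0).imp ((memF 12 1).imp (memF 10 2))))))) F G X
    (by
      simp only [Language.Formula.realize_inf, Language.Formula.realize_sup,
        Language.Formula.realize_imp, Language.Formula.realize_not, realize_exF, realize_allF,
        realize_memF, realize_eqF, Function.update_apply, Nat.reduceEqDiff, if_true, if_false,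
        params, realize_pairF transClass_V, Nat.reduceLT]
      intro z c p e hF hG
      exact h z c (e ▸ hF) (e ▸ hG))
  simp only [Language.Formula.realize_inf, Language.Formula.realize_sup,
    Language.Formula.realize_imp, Language.Formula.realize_not, realize_exF, realize_allF,
    realize_memF, realize_eqF, Function.update_apply, Nat.reduceEqDiff, if_true, if_false, params,
    realize_pairF E.trans, Nat.reduceLT] at this
  intro z c hF hG
  exact this ⟨z, (E.mem_of_pair_mem hF).1⟩ ⟨c, (E.mem_of_pair_mem hF).2⟩
    ⟨_, E.mem_of_mem hF⟩ rfl hF hG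

theorem pair_imp_exists {F H : ZFSet.{u}}
    (h : ∀ z c y, ZFSet.pair z c ∈ F → y ∈ c →
      ∃ b ∈ z, ZFSet.pair z (ZFSet.pair b y) ∈ H) :
    ∀ z c y, ZFSet.pair z c ∈ E.e.j F → y ∈ c →
      ∃ b ∈ z, ZFSet.pair z (ZFSet.pair b y) ∈ E.e.j H := by
  have := E.e.transfer (allF 10 (allF 11 (allF 12 (allF 13 ((pairF 13 10 11).imp ((memF 13 0).imp
    ((memF 12 11).imp (exF 14 (memF 14 10 ⊓ exF 15 (exF 16 (memF 16 1 ⊓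
      (pairF 16 10 15 ⊓ pairF 15 14 12)))))))))))) F H ∅
    (by
      simp only [Language.Formula.realize_inf, Language.Formula.realize_sup,
        Language.Formula.realize_imp, Language.Formula.realize_not, realize_exF, realize_allF,
        realize_memF, realize_eqF, Function.update_apply, Nat.reduceEqDiff, if_true, if_false,
        params, realize_pairF transClass_V, Nat.reduceLT]
      intro z c y p e hp hy
      obtain ⟨b, hb, hq⟩ := h z c y (e ▸ hp) hy
      exact ⟨⟨b, trivial⟩, hb, ⟨_, trivial⟩, ⟨_, trivial⟩, hq, rfl, rfl⟩)
  simp only [Language.Formula.realize_inf, Language.Formula.realize_sup,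
    Language.Formula.realize_imp, Language.Formula.realize_not, realize_exF, realize_allF,
    realize_memF, realize_eqF, Function.update_apply, Nat.reduceEqDiff, if_true, if_false, params,
    realize_pairF E.trans, Nat.reduceLT] at this
  intro z c y hF hy
  obtain ⟨b, hb, q, p, hp, e, e'⟩ := this ⟨z, (E.mem_of_pair_mem hF).1⟩
    ⟨c, (E.mem_of_pair_mem hF).2⟩ ⟨y, E.trans _ (E.mem_of_pair_mem hF).2 _ hy⟩
    ⟨_, E.mem_of_mem hF⟩ rfl hF hy
  exact ⟨b, hb, by rw [← e', ← e]; exact hp⟩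

theorem pair_pair_imp_pair {b H G : ZFSet.{u}}
    (h : ∀ z y, ZFSet.pair z (ZFSet.pair b y) ∈ H → ZFSet.pair z y ∈ G) :
    ∀ z y, ZFSet.pair z (ZFSet.pair (E.e.j b) y) ∈ E.e.j H → ZFSet.pair z y ∈ E.e.j G := by
  have := E.e.transfer (allF 10 (allF 11 (allF 12 (allF 13 ((pairF 12 0 11).imp ((pairF 13 10 12).imp
    ((memF 13 1).imp (exF 14 (memF 14 2 ⊓ pairF 14 10 11))))))))) b H G
    (by
      simp only [Language.Formula.realize_inf, Language.Formula.realize_sup,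
        Language.Formula.realize_imp, Language.Formula.realize_not, realize_exF, realize_allF,
        realize_memF, realize_eqF, Function.update_apply, Nat.reduceEqDiff, if_true, if_false,
        params, realize_pairF transClass_V, Nat.reduceLT]
      intro z y q p e e' hp
      exact ⟨⟨_, trivial⟩, h z y (by rw [← e, ← e']; exact hp), rfl⟩)
  simp only [Language.Formula.realize_inf, Language.Formula.realize_sup,
    Language.Formula.realize_imp, Language.Formula.realize_not, realize_exF, realize_allF,
    realize_memF, realize_eqF, Function.update_apply, Nat.reduceEqDiff, if_true, if_false, params,
    realize_pairF E.trans, Nat.reduceLT] at this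
  intro z y hH
  have hq := E.mem_of_pair_mem hH
  obtain ⟨p, hp, e⟩ := this ⟨z, hq.1⟩ ⟨y, by
    have hs := E.trans _ hq.2 {E.e.j b, y} (by simp [ZFSet.pair])
    exact E.trans _ hs _ (by simp)⟩ ⟨_, hq.2⟩ ⟨_, E.mem_of_mem hH⟩ rfl rfl hH
  exact e ▸ hp

end MeasEmb

end Transfer

/-- `U` concentrates on the ordinal `κ`, contains its final segments, and is closed under
diagonal intersections. -/
structure NormalOn (κ : ZFSet.{u}) (U : Ultrafilter ZFSet.{u}) : Prop where
  isOrdinal : κ.IsOrdinal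
  mem : ∀ᶠ δ in U, δ ∈ κ
  unbounded : ∀ γ ∈ κ, ∀ᶠ δ : ZFSet.{u} in U, γ ∈ δ
  diag : ∀ P : ZFSet.{u} → ZFSet.{u} → Prop,
    (∀ α ∈ κ, ∀ᶠ δ in U, P α δ) → ∀ᶠ δ in U, ∀ α ∈ δ, P α δ

namespace NormalOn

variable {κ : ZFSet.{u}} {U : Ultrafilter ZFSet.{u}}

theorem fodor (hU : NormalOn κ U) {f : ZFSet.{u} → ZFSet.{u}} (h : ∀ᶠ δ in U, f δ ∈ δ) :
    ∃ α ∈ κ, ∀ᶠ δ in U, f δ = α := by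
  by_contra! hc
  have := hU.diag (fun α δ => f δ ≠ α) hc
  obtain ⟨δ, h1, h2⟩ := (h.and this).exists
  exact h2 _ h1 rfl

theorem exists_strictMono (hU : NormalOn κ U) :
    ∃ a : ℕ → ZFSet.{u}, (∀ n, a n ∈ κ) ∧ ∀ m n, m < n → a m ∈ a n := by
  have step : ∀ x : {x // x ∈ κ}, ∃ y : {x // x ∈ κ}, (x : ZFSet) ∈ (y : ZFSet) := fun x => by
    obtain ⟨δ, h1, h2⟩ := (hU.mem.and (hU.unbounded x x.2)).exists
    exact ⟨⟨δ, h1⟩, h2⟩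
  choose g hg using step
  obtain ⟨δ, hδ⟩ := hU.mem.exists
  refine ⟨fun n => ((g^[n] ⟨δ, hδ⟩ : {x // x ∈ κ}) : ZFSet), fun n => Subtype.property _, ?_⟩
  intro m n hmn
  induction n, hmn using Nat.le_induction with
  | base => simp only [Nat.succ_eq_add_one, Function.iterate_succ_apply']; exact hg _
  | succ n _ ih =>
    refine (hU.isOrdinal.mem (Subtype.property _)).mem_trans ih ?_
    simp only [Function.iterate_succ_apply']
    exact hg _

theorem eventually_forall_nat (hU : NormalOn κ U) {P : ℕ → ZFSet.{u} → Prop}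
    (h : ∀ n, ∀ᶠ δ in U, P n δ) : ∀ᶠ δ in U, ∀ n, P n δ := by
  classical
  obtain ⟨a, ha, hlt⟩ := hU.exists_strictMono
  have inj : Function.Injective a := by
    intro m n hmn
    rcases lt_trichotomy m n with h | h | h
    · exact absurd (hmn ▸ hlt m n h) (ZFSet.mem_irrefl _)
    · exact h
    · exact absurd (hmn ▸ hlt n m h) (ZFSet.mem_irrefl _)
  have key : ∀ g : ZFSet.{u} → ℕ, (∀ᶠ δ in U, a (g δ) ∈ δ) → ∃ m, ∀ᶠ δ in U, g δ = m := by
    intro g hg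
    obtain ⟨α, -, hα⟩ := hU.fodor hg
    obtain ⟨δ₀, h₀⟩ := hα.exists
    exact ⟨g δ₀, hα.mono fun δ hδ => inj (hδ.trans h₀.symm)⟩
  have hall : ∀ᶠ δ : ZFSet.{u} in U, ∀ n, a n ∈ δ := by
    by_contra hc
    rw [← Ultrafilter.eventually_not] at hc
    push Not at hc
    have hk : ∀ᶠ δ : ZFSet.{u} in U, ∃ n, a n ∈ δ ∧ a (n + 1) ∉ δ := by
      filter_upwards [hc, hU.unbounded _ (ha 0)] with δ h1 h2
      by_contra! h3
      obtain ⟨n, hn⟩ := h1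
      exact hn (Nat.rec h2 h3 n)
    obtain ⟨m, hm⟩ := key (fun δ => if h : ∃ n, a n ∈ δ ∧ a (n + 1) ∉ δ then h.choose else 0)
      (by
        filter_upwards [hk] with δ h
        rw [dif_pos h]
        exact h.choose_spec.1)
    obtain ⟨δ, h1, h2, h3⟩ := (hm.and (hk.and (hU.unbounded _ (ha (m + 1))))).exists
    rw [dif_pos h2] at h1
    exact h2.choose_spec.2 (h1 ▸ h3)
  by_contra hc
  rw [← Ultrafilter.eventually_not] at hc
  push Not at hc
  obtain ⟨m, hm⟩ := key (fun δ => if h : ∃ n, ¬ P n δ then h.choose else 0)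
    (hall.mono fun δ hδ => hδ _)
  obtain ⟨δ, h1, h2, h3⟩ := (hm.and (hc.and (h m))).exists
  rw [dif_pos h2] at h1
  exact h2.choose_spec (h1 ▸ h3)

theorem eventually_forall_countable (hU : NormalOn κ U) {ι : Type*} [Countable ι]
    {P : ι → ZFSet.{u} → Prop} (h : ∀ i, ∀ᶠ δ in U, P i δ) : ∀ᶠ δ in U, ∀ i, P i δ := by
  obtain ⟨e, he⟩ := exists_injective_nat ι
  have := hU.eventually_forall_nat (P := fun n δ => ∀ i, e i = n → P i δ) fun n => by
    by_cases hn : ∃ i, e i = n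
    · obtain ⟨i, rfl⟩ := hn
      exact (h i).mono fun δ hδ k hk => he hk ▸ hδ
    · exact Eventually.of_forall fun δ i hi => absurd ⟨i, hi⟩ hn
  exact this.mono fun δ hδ i => hδ _ i rfl

theorem diag_pi (hU : NormalOn κ U) {n : ℕ} {Q : (Fin n → ZFSet.{u}) → ZFSet.{u} → Prop}
    (h : ∀ a : Fin n → ZFSet.{u}, (∀ i, a i ∈ κ) → ∀ᶠ δ in U, Q a δ) :
    ∀ᶠ δ in U, ∀ a : Fin n → ZFSet.{u}, (∀ i, a i ∈ δ) → Q a δ := by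
  induction n with
  | zero =>
    exact (h Fin.elim0 fun i => i.elim0).mono fun δ hδ a _ => Subsingleton.elim Fin.elim0 a ▸ hδ
  | succ n ih =>
    have := hU.diag (fun x δ => ∀ a : Fin n → ZFSet.{u}, (∀ i, a i ∈ δ) → Q (Fin.cons x a) δ)
      fun x hx => ih fun a ha => h _ (Fin.cases hx ha)
    filter_upwards [this] with δ hδ a ha
    have := hδ (a 0) (ha 0) (Fin.tail a) fun i => ha i.succ
    rwa [Fin.cons_self_tail] at this

/-- Normality is preserved by integrating a family of normal measures on smaller ordinals. -/
theorem bind (hU : NormalOn κ U) {W : ZFSet.{u} → Ultrafilter ZFSet.{u}}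
    (hW : ∀ᶠ δ in U, NormalOn δ (W δ)) : NormalOn κ (U.bind W) where
  isOrdinal := hU.isOrdinal
  mem := by
    change ∀ᶠ δ in U, ∀ᶠ ε in W δ, ε ∈ κ
    filter_upwards [hW, hU.mem] with δ h1 h2
    exact h1.mem.mono fun ε hε => hU.isOrdinal.mem_trans hε h2
  unbounded γ hγ := by
    change ∀ᶠ δ in U, ∀ᶠ ε : ZFSet.{u} in W δ, γ ∈ ε
    filter_upwards [hW, hU.unbounded γ hγ] with δ h1 h2
    exact h1.unbounded γ h2
  diag P h := by
    change ∀ᶠ δ in U, ∀ᶠ ε in W δ, ∀ α ∈ ε, P α ε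
    have : ∀ᶠ δ in U, ∀ α ∈ δ, ∀ᶠ ε in W δ, P α ε := hU.diag _ h
    filter_upwards [hW, this] with δ h1 h2
    exact h1.diag P h2

end NormalOn

section Derived

variable {κ : ZFSet.{u}}

namespace MeasEmb

variable (E : MeasEmb κ)

theorem mem_sep_not_iff (p : ZFSet.{u} → Prop) :
    κ ∈ E.e.j (ZFSet.sep (fun x => ¬ p x) κ) ↔ κ ∉ E.e.j (ZFSet.sep p κ) := by
  constructor
  · exact fun h => E.forall_not (X := ZFSet.sep (fun x => ¬ p x) κ) (Y := ZFSet.sep p κ)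
      (fun z hz hz' => (ZFSet.mem_sep.1 hz).2 (ZFSet.mem_sep.1 hz').2) κ h
  · intro h
    refine (E.forall_or (X := κ) (Y := ZFSet.sep p κ) (fun z hz => ?_) κ E.crit.2.1).resolve_left h
    by_cases hp : p z
    · exact Or.inl (ZFSet.mem_sep.2 ⟨hz, hp⟩)
    · exact Or.inr (ZFSet.mem_sep.2 ⟨hz, hp⟩)

theorem mem_sep_mono {p q : ZFSet.{u} → Prop} (h : ∀ z ∈ κ, p z → q z)
    (hp : κ ∈ E.e.j (ZFSet.sep p κ)) : κ ∈ E.e.j (ZFSet.sep q κ) :=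
  E.forall_imp (Y := ZFSet.sep p κ) (fun z hz hz' =>
    ZFSet.mem_sep.2 ⟨hz, h z hz (ZFSet.mem_sep.1 hz').2⟩) κ E.crit.2.1 hp

theorem mem_sep_and {p q : ZFSet.{u} → Prop}
    (hp : κ ∈ E.e.j (ZFSet.sep p κ)) (hq : κ ∈ E.e.j (ZFSet.sep q κ)) :
    κ ∈ E.e.j (ZFSet.sep (fun x => p x ∧ q x) κ) :=
  E.forall_imp (Y := ZFSet.sep q κ) (fun z hz hz' =>
    ZFSet.mem_sep.2 ⟨(ZFSet.mem_sep.1 hz).1, (ZFSet.mem_sep.1 hz).2, (ZFSet.mem_sep.1 hz').2⟩)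
    κ hp hq

/-- The ultrafilter derived from an elementary embedding, with its critical point as seed. -/
noncomputable def derived : Ultrafilter ZFSet.{u} :=
  Ultrafilter.ofComplNotMemIff
    { sets := {s | κ ∈ E.e.j (ZFSet.sep (· ∈ s) κ)}
      univ_sets := by
        have := E.crit.2.1
        rw [Set.mem_ofPred_eq]
        convert this
        ext z
        simp
      sets_of_superset := fun {s t} hs hst => E.mem_sep_mono (fun _ _ h => hst h) hs
      inter_sets := fun {s t} hs ht => E.mem_sep_and hs ht }
    (fun s => by
      have := E.mem_sep_not_iff (fun x => x ∈ s)
      exact (not_congr this).trans not_not)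

theorem eventually_derived {p : ZFSet.{u} → Prop} :
    (∀ᶠ δ in E.derived, p δ) ↔ κ ∈ E.e.j (ZFSet.sep p κ) := Iff.rfl

theorem normalOn_derived : NormalOn κ E.derived where
  isOrdinal := E.crit.1
  mem := by
    rw [eventually_derived]
    convert E.crit.2.1
    ext z
    simp
  unbounded γ hγ := by
    rw [eventually_derived]
    refine E.forall_mem_imp (α := γ) (X := κ) (fun z hz h => ZFSet.mem_sep.2 ⟨hz, h⟩) κ
      E.crit.2.1 ?_
    rwa [E.crit.2.2 γ (E.crit.1.mem hγ) hγ]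
  diag P h := by
    rw [eventually_derived]
    let F : ZFSet.{u} := ZFSet.sep (fun p => ∃ α ξ, p = ZFSet.pair α ξ ∧ ¬ P α ξ) (ZFSet.prod κ κ)
    have hF : ∀ δ ∈ κ, δ ∈ ZFSet.sep (fun δ => ∀ α ∈ δ, P α δ) κ ∨
        ∃ α ∈ δ, ZFSet.pair α δ ∈ F := by
      intro δ hδ
      by_cases hd : ∀ α ∈ δ, P α δ
      · exact Or.inl (ZFSet.mem_sep.2 ⟨hδ, hd⟩)
      · push Not at hd
        obtain ⟨α, hα, hn⟩ := hd
        refine Or.inr ⟨α, hα, ZFSet.mem_sep.2 ⟨?_, α, δ, rfl, hn⟩⟩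
        exact ZFSet.pair_mem_prod.2 ⟨E.crit.1.mem_trans hα hδ, hδ⟩
    rcases E.forall_or_exists_pair hF κ E.crit.2.1 with h' | ⟨α, hα, hF⟩
    · exact h'
    · have e := E.crit.2.2 α (E.crit.1.mem hα) hα
      have := h α hα
      rw [eventually_derived] at this
      have hn := E.forall_pair_notMem (α := α) (F := F) (fun z hz hp => by
        obtain ⟨a, b, hab, hn⟩ := (ZFSet.mem_sep.1 hp).2
        obtain ⟨rfl, rfl⟩ := ZFSet.pair_inj.1 hab
        exact hn (ZFSet.mem_sep.1 hz).2) κ this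
      rw [e] at hn
      exact absurd hF hn

end MeasEmb

end Derived

/-- The Mostowski-style collapse of `x` that only looks at elements of the form `t α` with
`α ∈ δ`. -/
noncomputable def coll (t : ZFSet.{u} → ZFSet.{u}) (δ : ZFSet.{u}) : ZFSet.{u} → ZFSet.{u} :=
  ZFSet.mem_wf.fix fun x ih =>
    ZFSet.range fun α : {α : δ // t α ∈ x} => ih (t α) α.2

theorem mem_coll {t : ZFSet.{u} → ZFSet.{u}} {δ x z : ZFSet.{u}} :
    z ∈ coll t δ x ↔ ∃ α ∈ δ, t α ∈ x ∧ z = coll t δ (t α) := by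
  rw [coll, WellFounded.fix_eq, ZFSet.mem_range]
  constructor
  · rintro ⟨α, rfl⟩
    exact ⟨α, α.1.2, α.2, rfl⟩
  · rintro ⟨α, hα, hx, rfl⟩
    exact ⟨⟨⟨α, hα⟩, hx⟩, rfl⟩

theorem coll_eq_self {t : ZFSet.{u} → ZFSet.{u}} {δ T : ZFSet.{u}} (hT : T.IsTransitive)
    (ht : ∀ y ∈ T, ∃ α ∈ δ, t α = y) (x : ZFSet.{u}) : x ∈ T → coll t δ x = x := by
  induction x using ZFSet.inductionOn with
  | _ x ih =>
    intro hx
    ext z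
    rw [mem_coll]
    constructor
    · rintro ⟨α, -, h, rfl⟩
      rwa [ih _ h (hT.mem_trans h hx)]
    · intro hz
      obtain ⟨α, hα, rfl⟩ := ht z (hT.mem_trans hz hx)
      exact ⟨α, hα, hz, (ih _ hz (hT.mem_trans hz hx)).symm⟩

theorem memH_coll {t : ZFSet.{u} → ZFSet.{u}} {κ α : ZFSet.{u}} (hα : α ∈ κ) :
    MemH κ (coll t κ (t α)) := by
  refine ⟨ZFSet.range fun β : κ => coll t κ (t β), ?_, ?_, ?_⟩
  · intro x hx y hy
    obtain ⟨β, rfl⟩ := ZFSet.mem_range.1 hx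
    obtain ⟨γ, hγ, -, rfl⟩ := mem_coll.1 hy
    exact ZFSet.mem_range.2 ⟨⟨γ, hγ⟩, rfl⟩
  · exact ZFSet.mem_range.2 ⟨⟨α, hα⟩, rfl⟩
  · refine Cardinal.mk_le_of_surjective (f := fun β : κ =>
      ⟨coll t κ (t β), ZFSet.mem_range.2 ⟨β, rfl⟩⟩) ?_
    rintro ⟨x, hx⟩
    obtain ⟨β, rfl⟩ := ZFSet.mem_range.1 hx
    exact ⟨β, rfl⟩

/-- The graph of `δ ↦ coll t δ (t α)` on the `δ ∈ κ` above `α`. -/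
noncomputable def collGraph (t : ZFSet.{u} → ZFSet.{u}) (κ α : ZFSet.{u}) : ZFSet.{u} :=
  ZFSet.range fun δ : {δ : κ // α ∈ (δ : ZFSet.{u})} => ZFSet.pair δ (coll t δ (t α))

theorem pair_mem_collGraph {t : ZFSet.{u} → ZFSet.{u}} {κ α δ c : ZFSet.{u}} :
    ZFSet.pair δ c ∈ collGraph t κ α ↔ δ ∈ κ ∧ α ∈ δ ∧ c = coll t δ (t α) := by
  rw [collGraph, ZFSet.mem_range]
  constructor
  · rintro ⟨ε, h⟩
    obtain ⟨rfl, rfl⟩ := ZFSet.pair_inj.1 h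
    exact ⟨ε.1.2, ε.2, rfl⟩
  · rintro ⟨h1, h2, rfl⟩
    exact ⟨⟨⟨δ, h1⟩, h2⟩, rfl⟩

/-- The set of all `(δ, (β, coll t δ (t β)))` with `β ∈ δ ∈ κ` and `t β ∈ x`. -/
noncomputable def collElems (t : ZFSet.{u} → ZFSet.{u}) (κ x : ZFSet.{u}) : ZFSet.{u} :=
  ZFSet.range fun q : {q : κ × κ // (q.2 : ZFSet.{u}) ∈ (q.1 : ZFSet.{u}) ∧ t q.2 ∈ x} =>
    ZFSet.pair q.1.1 (ZFSet.pair q.1.2 (coll t q.1.1 (t q.1.2)))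

theorem pair_mem_collElems {t : ZFSet.{u} → ZFSet.{u}} {κ x δ β c : ZFSet.{u}}
    (hκ : κ.IsTransitive) :
    ZFSet.pair δ (ZFSet.pair β c) ∈ collElems t κ x ↔
      δ ∈ κ ∧ β ∈ δ ∧ t β ∈ x ∧ c = coll t δ (t β) := by
  rw [collElems, ZFSet.mem_range]
  constructor
  · rintro ⟨q, h⟩
    obtain ⟨rfl, h'⟩ := ZFSet.pair_inj.1 h
    obtain ⟨rfl, rfl⟩ := ZFSet.pair_inj.1 h'
    exact ⟨q.1.1.2, q.2.1, q.2.2, rfl⟩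
  · rintro ⟨h1, h2, h3, rfl⟩
    exact ⟨⟨⟨⟨δ, h1⟩, ⟨β, hκ.mem_trans h2 h1⟩⟩, h2, h3⟩, rfl⟩

namespace MeasEmb

variable {κ : ZFSet.{u}} (E : MeasEmb κ)

theorem pair_coll_mem (t : ZFSet.{u} → ZFSet.{u}) (x : ZFSet.{u}) :
    ∀ α ∈ κ, t α = x → ZFSet.pair κ (coll t κ (t α)) ∈ E.e.j (collGraph t κ α) := by
  have fix : ∀ α ∈ κ, E.e.j α = α := fun α hα => E.crit.2.2 α (E.crit.1.mem hα) hα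
  induction x using ZFSet.inductionOn with
  | _ x ih =>
    rintro α hα rfl
    have hκ : κ ∈ E.e.j (ZFSet.sep (α ∈ ·) κ) :=
      E.eventually_derived.1 (E.normalOn_derived.unbounded α hα)
    obtain ⟨c, hc⟩ := E.exists_pair (F := collGraph t κ α) (fun δ hδ =>
      ⟨_, pair_mem_collGraph.2 ⟨(ZFSet.mem_sep.1 hδ).1, (ZFSet.mem_sep.1 hδ).2, rfl⟩⟩) κ hκ
    suffices h : c = coll t κ (t α) from h ▸ hc
    ext y
    constructor
    · intro hy
      obtain ⟨β, hβ, hH⟩ := E.pair_imp_exists (H := collElems t κ (t α)) (fun δ c y hc hy => by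
        obtain ⟨h1, -, rfl⟩ := pair_mem_collGraph.1 hc
        obtain ⟨β, hβ, h, rfl⟩ := mem_coll.1 hy
        exact ⟨β, hβ, (pair_mem_collElems E.crit.1.isTransitive).2 ⟨h1, hβ, h, rfl⟩⟩) κ c y hc hy
      rw [← fix β hβ] at hH
      by_cases hx : t β ∈ t α
      · have hy' := E.pair_pair_imp_pair (G := collGraph t κ β) (fun δ y h => by
          obtain ⟨h1, h2, -, rfl⟩ := (pair_mem_collElems E.crit.1.isTransitive).1 h
          exact pair_mem_collGraph.2 ⟨h1, h2, rfl⟩) κ y hH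
        refine mem_coll.2 ⟨β, hβ, hx, ?_⟩
        refine E.pair_imp_eq (fun z c d h h' => ?_) κ _ _ hy' (ih _ hx β hβ rfl)
        exact (pair_mem_collGraph.1 h).2.2.trans (pair_mem_collGraph.1 h').2.2.symm
      · have hy' := E.pair_pair_imp_pair (G := ∅) (fun δ y h =>
          absurd ((pair_mem_collElems E.crit.1.isTransitive).1 h).2.2.1 hx) κ y hH
        exact absurd hy' (E.forall_not (fun z h _ => ZFSet.notMem_empty z h) _ hy')
    · intro hy
      obtain ⟨β, hβ, hx, rfl⟩ := mem_coll.1 hy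
      refine E.pair_imp_mem (fun z c d h h' => ?_) κ _ _ (ih _ hx β hβ rfl) hc
      obtain ⟨-, h2, rfl⟩ := pair_mem_collGraph.1 h
      obtain ⟨-, -, rfl⟩ := pair_mem_collGraph.1 h'
      exact mem_coll.2 ⟨β, h2, hx, rfl⟩

end MeasEmb

theorem exists_normalOn_eventually_eq_coll {ℓ : ZFSet.{u} → ZFSet.{u}} (h : UnivLDmeas ℓ)
    {κ : ZFSet.{u}} (hκ : MeasurableCard κ) (t : ZFSet.{u} → ZFSet.{u}) {α : ZFSet.{u}}
    (hα : α ∈ κ) : ∃ U, NormalOn κ U ∧ ∀ᶠ δ in U, ℓ δ = coll t δ (t α) := by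
  obtain ⟨r, hr, -, hA⟩ := h κ hκ
  obtain ⟨E, hE⟩ := hA _ (memH_coll hα)
  refine ⟨E.derived, E.normalOn_derived, E.eventually_derived.2 ?_⟩
  refine E.pair_pair_imp (fun δ c h h' => ?_) κ _ hE (E.pair_coll_mem t _ α hα rfl)
  obtain ⟨γ, hγ, e⟩ := (hr _).1 h
  obtain ⟨rfl, rfl⟩ := ZFSet.pair_inj.1 e
  exact ZFSet.mem_sep.2 ⟨hγ, (pair_mem_collGraph.1 h').2.2⟩

theorem exists_normalOn_not_measurable {ℓ : ZFSet.{u} → ZFSet.{u}} (h : UnivLDmeas ℓ)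
    (t : ZFSet.{u} → ZFSet.{u}) {α : ZFSet.{u}} (κ : ZFSet.{u}) :
    MeasurableCard κ → α ∈ κ →
      ∃ U, NormalOn κ U ∧ ∀ᶠ δ in U, ℓ δ = coll t δ (t α) ∧ ¬ MeasurableCard δ := by
  classical
  induction κ using ZFSet.inductionOn with
  | _ κ ih =>
    intro hκ hα
    obtain ⟨U, hU, hc⟩ := exists_normalOn_eventually_eq_coll h hκ t hα
    by_cases hm : ∀ᶠ δ in U, ¬ MeasurableCard δ
    · exact ⟨U, hU, hc.and hm⟩
    have hm' : ∀ᶠ δ in U, MeasurableCard δ := by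
      rw [← Ultrafilter.eventually_not] at hm
      exact hm.mono fun _ => not_not.1
    let W : ZFSet.{u} → Ultrafilter ZFSet.{u} := fun δ =>
      if hδ : ∃ U, NormalOn δ U ∧ ∀ᶠ δ in U, ℓ δ = coll t δ (t α) ∧ ¬ MeasurableCard δ
      then hδ.choose else pure ∅
    have hW : ∀ᶠ δ in U, NormalOn δ (W δ) ∧
        ∀ᶠ ε in W δ, ℓ ε = coll t ε (t α) ∧ ¬ MeasurableCard ε := by
      filter_upwards [hU.mem, hm', hU.unbounded α hα] with δ h1 h2 h3
      have hδ := ih δ h1 h2 h3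
      simp only [W, dif_pos hδ]
      exact hδ.choose_spec
    exact ⟨U.bind W, hU.bind (hW.mono fun _ h => h.1), hW.mono fun _ h => h.2⟩

/-- Mostowski collapse: a wellfounded, set-like, extensional structure for the language of set
theory is isomorphic to a transitive class. -/
theorem exists_mostowski {Q : Type (u + 1)} (R : Q → Q → Prop) (wf : WellFounded R)
    (hsmall : ∀ q, Small.{u} {p // R p q}) (ext : ∀ q q', (∀ p, R p q ↔ R p q') → q = q') :
    ∃ π : Q → ZFSet.{u}, TransClass (Set.range π) ∧ Function.Injective π ∧
      ∀ p q, π p ∈ π q ↔ R p q := by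
  let π : Q → ZFSet.{u} := wf.fix fun q ih => ZFSet.range fun p : {p // R p q} => ih p p.2
  have hπ : ∀ q z, z ∈ π q ↔ ∃ p, R p q ∧ π p = z := by
    intro q z
    simp only [π]
    rw [WellFounded.fix_eq, ZFSet.mem_range]
    exact ⟨fun ⟨p, h⟩ => ⟨p, p.2, h⟩, fun ⟨p, hp, h⟩ => ⟨⟨p, hp⟩, h⟩⟩
  have inj : Function.Injective π := by
    intro q
    induction q using wf.induction with
    | _ q ih =>
      intro q' h
      refine ext _ _ fun p => ⟨fun hp => ?_, fun hp => ?_⟩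
      · obtain ⟨p', hp', e⟩ := (hπ q' (π p)).1 (h ▸ (hπ _ _).2 ⟨p, hp, rfl⟩)
        exact ih p hp e.symm ▸ hp'
      · obtain ⟨p', hp', e⟩ := (hπ q (π p)).1 (h ▸ (hπ _ _).2 ⟨p, hp, rfl⟩)
        exact ih p' hp' e ▸ hp'
  refine ⟨π, ?_, inj, fun p q => ?_⟩
  · rintro _ ⟨q, rfl⟩ z hz
    obtain ⟨p, -, rfl⟩ := (hπ _ _).1 hz
    exact ⟨p, rfl⟩
  · rw [hπ]
    exact ⟨fun ⟨p', h, e⟩ => inj e ▸ h, fun h => ⟨p, h, rfl⟩⟩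

/-- A transitive collapse of the ultraproduct of the classes `C δ` by `U`. -/
structure Collapse (U : Ultrafilter ZFSet.{u}) (C : ZFSet.{u} → Set ZFSet.{u}) where
  π : (∀ δ, C δ) → ZFSet.{u}
  trans : TransClass (Set.range π)
  realize_iff : ∀ (φ : SetLang.Formula ℕ) (f : ℕ → ∀ δ, C δ),
    φ.Realize (fun i => (⟨π (f i), Set.mem_range_self _⟩ : Set.range π)) ↔
      ∀ᶠ δ in U, φ.Realize (fun i => f i δ)

section

variable {κ : ZFSet.{u}} {U : Ultrafilter ZFSet.{u}} {C : ZFSet.{u} → Set ZFSet.{u}}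

theorem NormalOn.nonempty_collapse (hU : NormalOn κ U) (hC : ∀ δ, TransClass (C δ))
    (hne : ∀ δ, (C δ).Nonempty) : Nonempty (Collapse U C) := by
  classical
  have (δ : ZFSet.{u}) : Nonempty (C δ) := (hne δ).to_subtype
  let Q : Type (u + 1) := (U : Filter ZFSet.{u}).Product fun δ => C δ
  let mk : (∀ δ, C δ) → Q := fun f => (f : (U : Filter ZFSet.{u}).Product fun δ => C δ)
  have mk_surj : Function.Surjective mk := Quotient.mk_surjective
  have mk_eq : ∀ f g, mk f = mk g ↔ ∀ᶠ δ in U, f δ = g δ := fun f g => Quotient.eq''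
  let R : Q → Q → Prop := fun p q =>
    Language.Structure.RelMap (L := SetLang) (M := Q) memRel.mem ![p, q]
  have hR : ∀ f g, R (mk f) (mk g) ↔ ∀ᶠ δ in U, (f δ : ZFSet) ∈ (g δ : ZFSet) := by
    intro f g
    have e : ![mk f, mk g] = fun i => mk (![f, g] i) := by
      funext i
      fin_cases i <;> rfl
    simp only [R, e]
    exact @Language.relMap_quotient_mk' SetLang _
      ((U : Filter ZFSet.{u}).productSetoid fun δ => C δ)
      (Language.Ultraproduct.setoidPrestructure _ U) 2 memRel.mem ![f, g]
  have wf : WellFounded R := by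
    refine wellFounded_iff_isEmpty_descending_chain.2 ⟨fun ⟨q, hq⟩ => ?_⟩
    choose f hf using fun n => mk_surj (q n)
    have : ∀ᶠ δ in U, ∀ n, (f (n + 1) δ : ZFSet) ∈ (f n δ : ZFSet) :=
      hU.eventually_forall_nat fun n => (hR _ _).1 (by rw [hf, hf]; exact hq n)
    obtain ⟨δ, hδ⟩ := this.exists
    exact (wellFounded_iff_isEmpty_descending_chain.1 ZFSet.mem_wf).false
      ⟨fun n => (f n δ : ZFSet), hδ⟩
  have hsmall : ∀ q, Small.{u} {p // R p q} := by
    intro q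
    obtain ⟨g, rfl⟩ := mk_surj q
    let T : Type (u + 1) := ∀ δ : κ, Option (g δ : ZFSet.{u})
    have (δ : κ) : Small.{u} (Option (g δ : ZFSet.{u})) :=
      small_of_injective (Equiv.optionEquivSumPUnit.{0} _).injective
    have : Small.{u} T := inferInstanceAs (Small.{u} (∀ δ : κ, Option (g δ : ZFSet.{u})))
    let F : T → Q := fun h => mk fun δ =>
      if hδ : δ ∈ κ then (h ⟨δ, hδ⟩).elim (g δ) fun x => ⟨x, hC _ _ (g δ).2 _ x.2⟩ else g δ
    have hF : {p | R p (mk g)} ⊆ Set.range F := by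
      intro p hp
      obtain ⟨f, rfl⟩ := mk_surj p
      refine ⟨fun δ => if h : (f δ : ZFSet) ∈ (g δ : ZFSet) then some ⟨f δ, h⟩ else none,
        (mk_eq _ _).2 ?_⟩
      filter_upwards [hU.mem, (hR _ _).1 hp] with δ h1 h2
      simp [h1, h2]
    exact small_subset hF
  have ext : ∀ q q', (∀ p, R p q ↔ R p q') → q = q' := by
    have sub : ∀ f g, (∀ p, R p (mk f) → R p (mk g)) →
        ∀ᶠ δ in U, ∀ x ∈ (f δ : ZFSet), x ∈ (g δ : ZFSet) := by
      intro f g h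
      let k : ∀ δ, C δ := fun δ =>
        if hx : ∃ x ∈ (f δ : ZFSet), x ∉ (g δ : ZFSet) then
          ⟨hx.choose, hC _ _ (f δ).2 _ hx.choose_spec.1⟩ else f δ
      by_contra hc
      rw [← Ultrafilter.eventually_not] at hc
      push Not at hc
      have hk : ∀ᶠ δ in U, (k δ : ZFSet) ∈ (f δ : ZFSet) ∧ (k δ : ZFSet) ∉ (g δ : ZFSet) := by
        filter_upwards [hc] with δ hδ
        simp only [k, dif_pos hδ]
        exact hδ.choose_spec
      have := (hR _ _).1 (h (mk k) ((hR _ _).2 (hk.mono fun _ h => h.1)))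
      obtain ⟨δ, h1, h2⟩ := (hk.and this).exists
      exact h1.2 h2
    intro q q' h
    obtain ⟨f, rfl⟩ := mk_surj q
    obtain ⟨g, rfl⟩ := mk_surj q'
    rw [mk_eq]
    filter_upwards [sub f g fun p => (h p).1, sub g f fun p => (h p).2] with δ h1 h2
    exact Subtype.ext (ZFSet.ext fun x => ⟨h1 x, h2 x⟩)
  obtain ⟨π, htr, inj, hmem⟩ := exists_mostowski R wf hsmall ext
  have hrange : Set.range (π ∘ mk) = Set.range π := mk_surj.range_comp π
  let e : Q ≃[SetLang] Set.range (π ∘ mk) :=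
    { toEquiv := (Equiv.ofInjective π inj).trans (Equiv.setCongr hrange.symm)
      map_fun' := fun f => f.elim
      map_rel' := fun {n} r x => by
        cases r
        refine (hmem (x 0) (x 1)).trans (iff_of_eq ?_)
        simp only [R]
        congr 1
        funext i
        fin_cases i <;> rfl }
  refine ⟨⟨π ∘ mk, hrange ▸ htr, fun φ f => ?_⟩⟩
  exact (Language.StrongHomClass.realize_formula e φ (v := fun i => mk (f i))).trans
    (Language.Ultraproduct.realize_formula_cast φ f)

end

namespace Collapse

variable {κ : ZFSet.{u}} {U : Ultrafilter ZFSet.{u}} {C : ZFSet.{u} → Set ZFSet.{u}}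
  (K : Collapse U C)

theorem realize_iff_fin (d : ∀ δ, C δ) {n : ℕ} (φ : SetLang.Formula (Fin n))
    (f : Fin n → ∀ δ, C δ) :
    φ.Realize (fun i => (⟨K.π (f i), Set.mem_range_self _⟩ : Set.range K.π)) ↔
      ∀ᶠ δ in U, φ.Realize (fun i => f i δ) := by
  have := K.realize_iff (φ.relabel Fin.val) fun i => if h : i < n then f ⟨i, h⟩ else d
  simpa [Language.Formula.realize_relabel, Function.comp_def] using this

theorem mem_iff {f g : ∀ δ, C δ} :
    K.π f ∈ K.π g ↔ ∀ᶠ δ in U, (f δ : ZFSet) ∈ (g δ : ZFSet) := by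
  have := K.realize_iff (memF 0 1) fun i => if i = 0 then f else g
  simpa using this

theorem eq_iff {f g : ∀ δ, C δ} :
    K.π f = K.π g ↔ ∀ᶠ δ in U, (f δ : ZFSet) = (g δ : ZFSet) := by
  have := K.realize_iff (eqF 0 1) fun i => if i = 0 then f else g
  simpa using this

theorem eq_pair (hC : ∀ δ, TransClass (C δ)) {f g h : ∀ δ, C δ}
    (e : ∀ᶠ δ in U, (h δ : ZFSet) = ZFSet.pair (f δ) (g δ)) :
    K.π h = ZFSet.pair (K.π f) (K.π g) := by
  have := K.realize_iff (pairF 0 1 2) fun i => if i = 0 then h else if i = 1 then f else g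
  simp only [realize_pairF K.trans, realize_pairF (hC _), Nat.reduceLT] at this
  exact this.2 e

theorem exists_rep (d : ∀ δ, C δ) {x : ZFSet.{u} → ZFSet.{u}} (h : ∀ᶠ δ in U, x δ ∈ C δ) :
    ∃ g : ∀ δ, C δ, ∀ᶠ δ in U, (g δ : ZFSet) = x δ := by
  classical
  refine ⟨fun δ => if h : x δ ∈ C δ then ⟨x δ, h⟩ else d δ, h.mono fun δ h => ?_⟩
  simp [h]

theorem exists_of_mem {f : ∀ δ, C δ} {z : ZFSet.{u}} (hz : z ∈ K.π f) :
    ∃ g, K.π g = z ∧ ∀ᶠ δ in U, (g δ : ZFSet) ∈ (f δ : ZFSet) := by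
  obtain ⟨g, rfl⟩ := K.trans _ ⟨f, rfl⟩ z hz
  exact ⟨g, rfl, K.mem_iff.1 hz⟩

theorem mem_of_eventually_mem (hC : ∀ δ, TransClass (C δ)) {f : ∀ δ, C δ}
    {x : ZFSet.{u} → ZFSet.{u}} {z : ZFSet.{u}} (hx : ∀ᶠ δ in U, x δ ∈ (f δ : ZFSet))
    (h : ∀ g : ∀ δ, C δ, (∀ᶠ δ in U, (g δ : ZFSet) = x δ) → K.π g = z) : z ∈ K.π f := by
  obtain ⟨g, hg⟩ := exists_rep f (hx.mono fun δ h => hC δ _ (f δ).2 _ h)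
  rw [← h g hg, K.mem_iff]
  filter_upwards [hx, hg] with δ h1 h2
  rwa [h2]

theorem eq_of_eventually_const (hU : NormalOn κ U) (hC : ∀ δ, TransClass (C δ))
    (α : ZFSet.{u}) : α ∈ κ → ∀ f : ∀ δ, C δ, (∀ᶠ δ in U, (f δ : ZFSet) = α) → K.π f = α := by
  induction α using ZFSet.inductionOn with
  | _ α ih =>
    intro hα f hf
    ext z
    constructor
    · intro hz
      obtain ⟨g, rfl, hg⟩ := K.exists_of_mem hz
      obtain ⟨β, hβ, hgβ⟩ := hU.fodor (f := fun δ => g δ) (by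
        filter_upwards [hU.mem, hU.unbounded α hα, hf, hg] with δ h1 h2 h3 h4
        exact (hU.isOrdinal.mem h1).mem_trans (h3 ▸ h4) h2)
      obtain ⟨δ, h1, h2, h3⟩ := (hf.and (hg.and hgβ)).exists
      have hβα : β ∈ α := by rwa [h3, h1] at h2
      rwa [ih β hβα hβ g hgβ]
    · intro hz
      exact K.mem_of_eventually_mem hC (hf.mono fun δ h => h.symm ▸ hz)
        (ih z hz (hU.isOrdinal.mem_trans hz hα))

theorem eq_of_eventually_id (hU : NormalOn κ U) (hC : ∀ δ, TransClass (C δ))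
    (f : ∀ δ, C δ) (hf : ∀ᶠ δ in U, (f δ : ZFSet) = δ) : K.π f = κ := by
  ext z
  constructor
  · intro hz
    obtain ⟨g, rfl, hg⟩ := K.exists_of_mem hz
    obtain ⟨β, hβ, hgβ⟩ := hU.fodor (f := fun δ => g δ) (by
      filter_upwards [hf, hg] with δ h1 h2
      generalize (f δ : ZFSet) = w at h1 h2
      exact h1 ▸ h2)
    rwa [K.eq_of_eventually_const hU hC β hβ g hgβ]
  · intro hz
    refine K.mem_of_eventually_mem hC (x := fun _ => z) ?_ (K.eq_of_eventually_const hU hC z hz)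
    filter_upwards [hU.unbounded z hz, hf] with δ h1 h2
    rwa [h2]

theorem eq_coll_of_eventually (hU : NormalOn κ U) (hC : ∀ δ, TransClass (C δ))
    (t : ZFSet.{u} → ZFSet.{u}) (x : ZFSet.{u}) :
    ∀ α ∈ κ, t α = x → ∀ f : ∀ δ, C δ,
      (∀ᶠ δ in U, (f δ : ZFSet) = coll t δ (t α)) → K.π f = coll t κ (t α) := by
  classical
  induction x using ZFSet.inductionOn with
  | _ x ih =>
    rintro α hα rfl f hf
    ext z
    constructor
    · intro hz
      obtain ⟨g, rfl, hg⟩ := K.exists_of_mem hz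
      have hβ : ∀ᶠ δ in U, ∃ β ∈ δ, t β ∈ t α ∧ (g δ : ZFSet) = coll t δ (t β) := by
        filter_upwards [hf, hg] with δ h1 h2
        exact mem_coll.1 (h1 ▸ h2)
      obtain ⟨β, hβκ, hb⟩ := hU.fodor (f := fun δ => if h : ∃ β ∈ δ, t β ∈ t α ∧
        (g δ : ZFSet) = coll t δ (t β) then h.choose else ∅) (by
          filter_upwards [hβ] with δ h
          rw [dif_pos h]
          exact h.choose_spec.1)
      have hb' : ∀ᶠ δ in U, t β ∈ t α ∧ (g δ : ZFSet) = coll t δ (t β) := by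
        filter_upwards [hβ, hb] with δ h h1
        rw [dif_pos h] at h1
        exact h1 ▸ h.choose_spec.2
      obtain ⟨δ, hβα, -⟩ := hb'.exists
      exact mem_coll.2 ⟨β, hβκ, hβα, ih _ hβα β hβκ rfl g (hb'.mono fun _ h => h.2)⟩
    · intro hz
      obtain ⟨β, hβ, hβα, rfl⟩ := mem_coll.1 hz
      refine K.mem_of_eventually_mem hC ?_ (ih _ hβα β hβ rfl)
      filter_upwards [hf, hU.unbounded β hβ] with δ h1 h2
      rw [h1]
      exact mem_coll.2 ⟨β, h2, hβα, rfl⟩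

end Collapse

theorem exists_enumeration {T δ : ZFSet.{u}} (hT : T.Nonempty)
    (h : Cardinal.mk T.toSet ≤ Cardinal.mk δ.toSet) :
    ∃ b : ZFSet.{u} → ZFSet.{u}, (∀ α, b α ∈ T) ∧ ∀ x ∈ T, ∃ α ∈ δ, b α = x := by
  classical
  obtain ⟨e⟩ := h
  obtain ⟨y, hy⟩ := hT
  refine ⟨fun α => if h : ∃ x : T.toSet, (e x : ZFSet) = α then (h.choose : ZFSet) else y,
    fun α => ?_, fun x hx => ⟨e ⟨x, hx⟩, (e ⟨x, hx⟩).2, ?_⟩⟩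
  · dsimp only
    split_ifs with h
    · exact h.choose.2
    · exact hy
  · have h : ∃ z : T.toSet, (e z : ZFSet) = e ⟨x, hx⟩ := ⟨_, rfl⟩
    dsimp only
    rw [dif_pos h]
    exact congrArg Subtype.val (e.injective (Subtype.ext h.choose_spec))

/-- The failure of weak compactness at `δ` is witnessed by a transitive set `m`. -/
theorem exists_witness_of_not_weaklyCompact (δ : ZFSet.{u}) :
    ∃ m : ZFSet.{u}, m.IsTransitive ∧ m.Nonempty ∧ (¬ WeaklyCompact δ →
      Cardinal.mk m.toSet = Cardinal.mk δ.toSet ∧ δ ∈ m ∧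
      ¬ ∃ N : ZFSet.{u}, N.IsTransitive ∧ ∃ e : ClassEmb m.toSet N.toSet, CritPt e.j δ) := by
  by_cases h : WeaklyCompact δ
  · refine ⟨{∅}, ?_, ⟨∅, ZFSet.mem_singleton.2 rfl⟩, fun h' => absurd h h'⟩
    intro y hy z hz
    rw [ZFSet.mem_singleton.1 hy] at hz
    exact absurd hz (ZFSet.notMem_empty z)
  · have h' := h
    rw [WeaklyCompact] at h'
    push Not at h'
    obtain ⟨M, h1, h2, h3, h4⟩ := h'
    refine ⟨M, h1, ⟨δ, h3⟩, fun _ => ⟨h2, h3, ?_⟩⟩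
    rintro ⟨N, hN, e, he⟩
    exact h4 N hN e he

instance : Countable (Σ n, SetLang.Formula (Fin n)) := by
  have h1 (n : ℕ) : Countable (SetLang.Functions n) := inferInstanceAs (Countable Empty)
  have h2 (n : ℕ) : Countable (SetLang.Relations n) := by
    have : Subsingleton (memRel n) := ⟨by rintro ⟨⟩ ⟨⟩; rfl⟩
    exact inferInstanceAs (Countable (memRel n))
  have : Countable SetLang.Symbols :=
    inferInstanceAs (Countable ((Σ l, SetLang.Functions l) ⊕ Σ l, SetLang.Relations l))
  infer_instance

theorem NormalOn.eventually_weaklyCompact {κ : ZFSet.{u}} {U : Ultrafilter ZFSet.{u}}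
    (hU : NormalOn κ U) : ∀ᶠ δ in U, WeaklyCompact δ := by
  classical
  by_contra hwc
  rw [← Ultrafilter.eventually_not] at hwc
  choose m hm hm0 hmw using exists_witness_of_not_weaklyCompact.{u}
  have hb (δ : ZFSet.{u}) : ∃ b : ZFSet.{u} → ZFSet.{u}, (∀ α, b α ∈ m δ) ∧
      (¬ WeaklyCompact δ → ∀ x ∈ m δ, ∃ α ∈ δ, b α = x) := by
    by_cases h : WeaklyCompact δ
    · obtain ⟨y, hy⟩ := hm0 δ
      exact ⟨fun _ => y, fun _ => hy, fun h' => absurd h h'⟩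
    · obtain ⟨b, h1, h2⟩ := exists_enumeration (hm0 δ) (hmw δ h).1.le
      exact ⟨b, h1, fun _ => h2⟩
  choose b hbm hbs using hb
  let C : ZFSet.{u} → Set ZFSet.{u} := fun δ => (m δ).toSet
  have hC (δ : ZFSet.{u}) : TransClass (C δ) := fun x hx y hy => (hm δ).mem_trans hy hx
  obtain ⟨K⟩ := hU.nonempty_collapse hC hm0
  let f : ZFSet.{u} → ∀ δ, C δ := fun α δ => ⟨b δ α, hbm δ α⟩
  let d : ∀ δ, C δ := f ∅
  have hrep (g : ∀ δ, C δ) : ∃ α ∈ κ, K.π (f α) = K.π g ∧ ∀ᶠ δ in U, b δ α = g δ := by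
    have h1 : ∀ᶠ δ in U, ∃ α ∈ δ, b δ α = g δ := hwc.mono fun δ h => hbs δ h _ (g δ).2
    obtain ⟨α, hα, h2⟩ := hU.fodor (f := fun δ => if h : ∃ α ∈ δ, b δ α = g δ then h.choose else ∅)
      (by
        filter_upwards [h1] with δ h
        rw [dif_pos h]
        exact h.choose_spec.1)
    have h3 : ∀ᶠ δ in U, b δ α = g δ := by
      filter_upwards [h1, h2] with δ h h'
      rw [dif_pos h] at h'
      exact h' ▸ h.choose_spec.2
    exact ⟨α, hα, K.eq_iff.2 h3, h3⟩
  let N : ZFSet.{u} := ZFSet.range fun α : κ => K.π (f α)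
  have hN : Set.range K.π = N.toSet := by
    ext z
    constructor
    · rintro ⟨g, rfl⟩
      obtain ⟨α, hα, h, -⟩ := hrep g
      exact ZFSet.mem_range.2 ⟨⟨α, hα⟩, h⟩
    · intro hz
      obtain ⟨α, hα⟩ := ZFSet.mem_range.1 hz
      exact ⟨_, hα⟩
  have hNtrans : N.IsTransitive := fun x hx y hy => by
    have := K.trans x (hN ▸ show x ∈ N.toSet from hx) y hy
    rwa [hN] at this
  have hc (δ x : ZFSet.{u}) : ∃ α, (x ∈ m δ → ¬ WeaklyCompact δ → α ∈ δ ∧ b δ α = x) := by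
    by_cases h : x ∈ m δ ∧ ¬ WeaklyCompact δ
    · obtain ⟨α, h1, h2⟩ := hbs δ h.2 x h.1
      exact ⟨α, fun _ _ => ⟨h1, h2⟩⟩
    · exact ⟨∅, fun h1 h2 => absurd ⟨h1, h2⟩ h⟩
  choose c hc using hc
  have helem : ∀ᶠ δ in U, ∀ (φ : Σ n, SetLang.Formula (Fin n)) (a : Fin φ.1 → ZFSet.{u}),
      (∀ i, a i ∈ δ) → (φ.2.Realize (fun i => f (a i) δ) ↔
        φ.2.Realize (fun i => (⟨K.π (f (a i)), Set.mem_range_self _⟩ : Set.range K.π))) :=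
    hU.eventually_forall_countable fun φ => hU.diag_pi fun a _ => by
      have := K.realize_iff_fin d φ.2 fun i => f (a i)
      by_cases h : ∀ᶠ δ in U, φ.2.Realize fun i => f (a i) δ
      · filter_upwards [h] with δ hδ
        exact iff_of_true hδ (this.2 h)
      · filter_upwards [Ultrafilter.eventually_not.2 h] with δ hδ
        exact iff_of_false hδ (fun h' => h (this.1 h'))
  have hfix : ∀ᶠ δ in U, ∀ α ∈ δ, K.π (f (c δ α)) = α := by
    refine hU.diag _ fun α hα => ?_
    have hαm : ∀ᶠ δ in U, α ∈ m δ := by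
      filter_upwards [hwc, hU.unbounded α hα] with δ h1 h2
      exact (hm δ).mem_trans h2 (hmw δ h1).2.1
    obtain ⟨g, hg⟩ := Collapse.exists_rep (U := U) d (x := fun _ => α) hαm
    obtain ⟨γ, -, h1⟩ := hU.fodor (f := fun δ => c δ α) (by
      filter_upwards [hwc, hαm] with δ h1 h2
      exact (hc δ α h2 h1).1)
    filter_upwards [h1] with δ h2
    rw [h2]
    refine K.eq_of_eventually_const hU hC α hα _ ?_
    filter_upwards [h1, hwc, hαm] with ε h3 h4 h5
    exact h3 ▸ (hc ε α h5 h4).2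
  have hself : ∀ᶠ δ in U, K.π (f (c δ δ)) = κ := by
    obtain ⟨γ, -, h1⟩ := hU.fodor (f := fun δ => c δ δ) (by
      filter_upwards [hwc] with δ h1
      exact (hc δ δ (hmw δ h1).2.1 h1).1)
    filter_upwards [h1] with δ h2
    rw [h2]
    refine K.eq_of_eventually_id hU hC _ ?_
    filter_upwards [h1, hwc] with ε h3 h4
    exact h3 ▸ (hc ε ε (hmw ε h4).2.1 h4).2
  obtain ⟨δ, h1, h2, h3, h4, h5⟩ := (hwc.and (helem.and (hfix.and (hself.and hU.mem)))).exists
  refine (hmw δ h1).2.2 ⟨N, hNtrans, ?_⟩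
  rw [← hN]
  refine ⟨⟨fun x => K.π (f (c δ x)), fun x _ => Set.mem_range_self _, ?_⟩, ?_⟩
  · intro n φ v hv
    refine Iff.trans (iff_of_eq ?_) (h2 ⟨n, φ⟩ (fun i => c δ (v i)) fun i => (hc δ _ (hv i) h1).1)
    congr 1
    funext i
    exact Subtype.ext (hc δ _ (hv i) h1).2.symm
  · exact ⟨hU.isOrdinal.mem h5, by dsimp only; rwa [h4], fun α _ hα => h3 α hα⟩

/-- The ultrapower of the universe by a normal ultrafilter is an embedding with critical point
`κ`, in which `κ` and the decoding of `t α` are represented by `δ ↦ δ` and `δ ↦ coll t δ (t α)`. -/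
theorem NormalOn.exists_measEmb {κ : ZFSet.{u}} {U : Ultrafilter ZFSet.{u}} (hU : NormalOn κ U)
    {ℓ t : ZFSet.{u} → ZFSet.{u}} {α r : ZFSet.{u}} (hα : α ∈ κ)
    (hℓ : ∀ᶠ δ in U, ℓ δ = coll t δ (t α)) (hr : ∀ᶠ δ in U, ZFSet.pair δ (ℓ δ) ∈ r) :
    ∃ E : MeasEmb κ, ZFSet.pair κ (coll t κ (t α)) ∈ E.e.j r := by
  have hC (δ : ZFSet.{u}) : TransClass ((fun _ => V.{u}) δ) := transClass_V
  obtain ⟨K⟩ := hU.nonempty_collapse (C := fun _ => V.{u}) hC fun _ => ⟨∅, trivial⟩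
  let c : ZFSet.{u} → ∀ δ : ZFSet.{u}, V.{u} := fun x _ => ⟨x, trivial⟩
  have hid : K.π (fun δ => ⟨δ, trivial⟩) = κ :=
    K.eq_of_eventually_id hU hC _ (Eventually.of_forall fun _ => rfl)
  have hA : K.π (fun δ => ⟨ℓ δ, trivial⟩) = coll t κ (t α) :=
    K.eq_coll_of_eventually hU hC t _ α hα rfl _ hℓ
  refine ⟨⟨Set.range K.π, K.trans, ⟨fun x => K.π (c x), fun x _ => ⟨_, rfl⟩, ?_⟩,
    hU.isOrdinal, ?_, ?_⟩, ?_⟩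
  · intro n φ v hv
    rw [K.realize_iff_fin (c ∅) φ fun i => c (v i)]
    exact eventually_const.symm
  · have : K.π (fun δ => ⟨δ, trivial⟩) ∈ K.π (c κ) := K.mem_iff.2 hU.mem
    rwa [hid] at this
  · exact fun β _ hβ => K.eq_of_eventually_const hU hC β hβ _ (Eventually.of_forall fun _ => rfl)
  · have h1 : K.π (fun δ => ⟨ZFSet.pair δ (ℓ δ), trivial⟩) = ZFSet.pair κ (coll t κ (t α)) := by
      have := K.eq_pair hC (f := fun δ => ⟨δ, trivial⟩) (g := fun δ => ⟨ℓ δ, trivial⟩)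
        (h := fun δ => ⟨ZFSet.pair δ (ℓ δ), trivial⟩) (Eventually.of_forall fun _ => rfl)
      rwa [hid, hA] at this
    rw [← h1]
    exact K.mem_iff.2 hr

end LaverDiamond

open LaverDiamond

/-- The restriction of any universal `LD^meas` Laver function to the class of
non-measurable weakly compact cardinals still witnesses `LD^meas`. -/
theorem restrict_univLDmeas_to_nonMeasurable_wc
    (ℓ : ZFSet.{u} → ZFSet.{u}) (h : UnivLDmeas ℓ) :
    ∀ κ : ZFSet, MeasurableCard κ →
      ∃ r : ZFSet,
        RestrictEqOn ℓ {δ : ZFSet.{u} | WeaklyCompact δ ∧ ¬ MeasurableCard δ} κ r ∧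
        LDmeasFun κ r := by
  intro κ hκ
  obtain ⟨r₀, hr₀, hP, -⟩ := h κ hκ
  set D := {δ : ZFSet.{u} | WeaklyCompact δ ∧ ¬ MeasurableCard δ}
  have hr : RestrictEqOn ℓ D κ
      (ZFSet.sep (fun p => ∃ γ : ZFSet, γ ∈ κ ∧ γ ∈ D ∧ p = ZFSet.pair γ (ℓ γ)) r₀) := by
    intro p
    rw [ZFSet.mem_sep, and_iff_right_iff_imp]
    rintro ⟨γ, h1, -, h2⟩
    exact (hr₀ p).2 ⟨γ, h1, h2⟩
  refine ⟨_, hr, ⟨fun p hp => hP.1 p (ZFSet.mem_sep.1 hp).1, fun γ A B hA hB =>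
    hP.2 γ A B (ZFSet.mem_sep.1 hA).1 (ZFSet.mem_sep.1 hB).1⟩, ?_⟩
  rintro A ⟨T, hT, hAT, hcard⟩
  obtain ⟨t, -, ht⟩ := exists_enumeration ⟨A, hAT⟩ hcard
  obtain ⟨α, hα, rfl⟩ := ht A hAT
  obtain ⟨U, hU, hUℓ⟩ := exists_normalOn_not_measurable h t κ hκ hα
  obtain ⟨E, hE⟩ := hU.exists_measEmb hα (hUℓ.mono fun _ h => h.1) (by
    filter_upwards [hU.mem, hUℓ, hU.eventually_weaklyCompact] with δ h1 h2 h3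
    exact (hr _).2 ⟨δ, h1, ⟨h3, h2.2⟩, rfl⟩)
  rw [coll_eq_self hT ht _ hAT] at hE
  exact ⟨E, hE⟩
end

section
/- If κ is a measurable cardinal, then LD^wc_κ holds: there is a partial function ℓ : κ ⇀ V_κ such that for every set A ∈ H(κ⁺) and every transitive structure M of size κ with A, ℓ ∈ M, there is a transitive set N and an elementary embedding j : M → N with critical point κ such that j(ℓ)(κ) = A. -/
open FirstOrder

universe u

open LaverDiamond

namespace LaverDiamond

/-! ### Satisfaction relative to a class, without subtypes -/

/-- The variable that a term of the (purely relational) language of set theory consists of. -/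
def termVar {β : Type} : SetLang.Term β → β
  | .var x => x
  | .func f _ => Empty.elim f

/-- Satisfaction of a formula in the class `X`, with an assignment that is allowed to take
arbitrary sets as values; only the quantifiers are bounded by `X`. -/
def Sat (X : Set ZFSet.{u}) {β : Type} :
    ∀ {n : ℕ}, SetLang.BoundedFormula β n → (β → ZFSet.{u}) → (Fin n → ZFSet.{u}) → Prop
  | _, .falsum, _, _ => False
  | _, .equal s t, v, xs => Sum.elim v xs (termVar s) = Sum.elim v xs (termVar t)
  | _, .rel memRel.mem ts, v, xs =>
      Sum.elim v xs (termVar (ts 0)) ∈ Sum.elim v xs (termVar (ts 1))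
  | _, .imp φ ψ, v, xs => Sat X φ v xs → Sat X ψ v xs
  | _, .all φ, v, xs => ∀ x ∈ X, Sat X φ v (Fin.snoc xs x)

theorem coe_realize_term {X : Set ZFSet.{u}} {β : Type} (t : SetLang.Term β) (w : β → X) :
    ((t.realize w : X) : ZFSet) = w (termVar t) := by
  cases t with
  | var x => rfl
  | func f _ => exact Empty.elim f

theorem realize_iff_sat {X : Set ZFSet.{u}} {β : Type} {n : ℕ}
    (φ : SetLang.BoundedFormula β n) (v : β → X) (xs : Fin n → X) :
    φ.Realize v xs ↔ Sat X φ (fun i => (v i : ZFSet)) (fun i => (xs i : ZFSet)) := by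
  have key : ∀ {m : ℕ} (ys : Fin m → X) (t : SetLang.Term (β ⊕ Fin m)),
      ((t.realize (Sum.elim v ys) : X) : ZFSet) =
        Sum.elim (fun i => (v i : ZFSet)) (fun i => (ys i : ZFSet)) (termVar t) := by
    intro m ys t
    rw [coe_realize_term]
    cases termVar t <;> rfl
  induction φ with
  | falsum => rfl
  | equal s t =>
    simp only [Sat, FirstOrder.Language.BoundedFormula.Realize, ← key, Subtype.ext_iff]
  | rel R ts =>
    cases R
    simp only [Sat, FirstOrder.Language.BoundedFormula.Realize, ← key]
    rfl
  | imp φ ψ ihφ ihψ => simp only [Sat, FirstOrder.Language.BoundedFormula.Realize, ihφ, ihψ]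
  | all φ ih =>
    simp only [Sat, FirstOrder.Language.BoundedFormula.Realize, ih, Subtype.forall]
    refine forall₂_congr fun x hx => ?_
    have : (fun i => ((Fin.snoc xs ⟨x, hx⟩ : Fin _ → X) i : ZFSet)) =
        Fin.snoc (fun i => (xs i : ZFSet)) x := by
      funext i
      refine Fin.lastCases ?_ (fun i => ?_) i <;> simp
    rw [this]

theorem formula_realize_iff_sat {X : Set ZFSet.{u}} {β : Type}
    (φ : SetLang.Formula β) (v : β → X) :
    φ.Realize v ↔ Sat X φ (fun i => (v i : ZFSet)) Fin.elim0 := by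
  unfold FirstOrder.Language.Formula.Realize
  rw [realize_iff_sat]
  exact iff_of_eq (congrArg _ (Subsingleton.elim _ _))

instance : Countable (Σ n, memRel n) :=
  Function.Injective.countable (f := fun _ => ()) (by
    rintro ⟨_, ⟨⟩⟩ ⟨_, ⟨⟩⟩ _
    rfl)

instance : Countable SetLang.Symbols :=
  inferInstanceAs (Countable ((Σ _ : ℕ, Empty) ⊕ (Σ n, memRel n)))

/-! ### Normal ultrafilters -/

/-- `U` is (an extension to all sets of) a normal ultrafilter on the uncountable ordinal `κ`. -/
structure IsNormalUltrafilter (κ : ZFSet.{u}) (U : Ultrafilter ZFSet.{u}) : Prop where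
  isOrdinal : κ.IsOrdinal
  mem : ∀ᶠ γ in U, γ ∈ κ
  tail : ∀ α : ZFSet.{u}, α ∈ κ → ∀ᶠ γ : ZFSet.{u} in U, α ∈ γ
  regressive : ∀ g : ZFSet.{u} → ZFSet.{u}, (∀ᶠ γ in U, g γ ∈ γ) →
    ∃ α : ZFSet.{u}, ∀ᶠ γ in U, g γ = α
  countable : CountableInterFilter (U : Filter ZFSet.{u})

namespace IsNormalUltrafilter

variable {κ : ZFSet.{u}} {U : Ultrafilter ZFSet.{u}}

theorem exists_mem_const (hU : IsNormalUltrafilter κ U) {g : ZFSet.{u} → ZFSet.{u}}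
    (hg : ∀ᶠ γ in U, g γ ∈ γ) : ∃ α ∈ κ, ∀ᶠ γ in U, g γ = α := by
  obtain ⟨α, hα⟩ := hU.regressive g hg
  obtain ⟨γ, h1, h2, h3⟩ := (hg.and (hα.and hU.mem)).exists
  exact ⟨α, h2 ▸ hU.isOrdinal.mem_trans h1 h3, hα⟩

/-- A function into a fixed element of `κ` is almost everywhere constant. -/
theorem exists_const_of_mem (hU : IsNormalUltrafilter κ U) {α : ZFSet.{u}} (hα : α ∈ κ)
    {g : ZFSet.{u} → ZFSet.{u}} (hg : ∀ᶠ γ in U, g γ ∈ α) :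
    ∃ β ∈ κ, ∀ᶠ γ in U, g γ = β := by
  refine hU.exists_mem_const ?_
  filter_upwards [hg, hU.tail α hα, hU.mem] with γ h1 h2 h3
  exact (hU.isOrdinal.mem h3).mem_trans h1 h2

/-- Closure under diagonal intersections. -/
theorem diagonal (hU : IsNormalUltrafilter κ U) {P : ZFSet.{u} → ZFSet.{u} → Prop}
    (h : ∀ α ∈ κ, ∀ᶠ γ in U, P α γ) : ∀ᶠ γ in U, ∀ α ∈ γ, P α γ := by
  by_contra hcon
  rw [Ultrafilter.eventually_not.symm] at hcon
  classical
  let g : ZFSet → ZFSet := fun γ => if h : ∃ α ∈ γ, ¬ P α γ then h.choose else ∅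
  have hg : ∀ᶠ γ in U, g γ ∈ γ ∧ ¬ P (g γ) γ := by
    filter_upwards [hcon] with γ hγ
    push Not at hγ
    simp only [g, dif_pos hγ]
    exact hγ.choose_spec
  obtain ⟨α, hα, hc⟩ := hU.exists_mem_const (hg.mono fun _ h => h.1)
  obtain ⟨γ, h1, h2, h3⟩ := (hg.and (hc.and (h α hα))).exists
  exact h1.2 (h2 ▸ h3)

theorem diagonal_tuple (hU : IsNormalUltrafilter κ U) {n : ℕ}
    {P : (Fin n → ZFSet.{u}) → ZFSet.{u} → Prop}
    (h : ∀ v : Fin n → ZFSet.{u}, (∀ i, v i ∈ κ) → ∀ᶠ γ in U, P v γ) :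
    ∀ᶠ γ in U, ∀ v : Fin n → ZFSet.{u}, (∀ i, v i ∈ γ) → P v γ := by
  induction n with
  | zero =>
    filter_upwards [h Fin.elim0 (fun i => i.elim0)] with γ hγ v _
    rwa [Subsingleton.elim v Fin.elim0]
  | succ n ih =>
    have h' : ∀ α ∈ κ, ∀ᶠ γ in U, ∀ v : Fin n → ZFSet.{u}, (∀ i, v i ∈ γ) →
        P (Fin.cons α v) γ := fun α hα => ih fun v hv => h _ fun i => by
      refine Fin.cases ?_ (fun i => ?_) i
      · simpa using hα
      · simpa using hv i
    filter_upwards [hU.diagonal h'] with γ hγ v hv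
    rw [← Fin.cons_self_tail v]
    exact hγ _ (hv 0) _ fun i => hv i.succ

/-- A function into a fixed set of rank below `κ` is almost everywhere constant. -/
theorem exists_const_of_rank_lt (hU : IsNormalUltrafilter κ U) :
    ∀ ρ < κ.rank, ∀ g : ZFSet.{u} → ZFSet.{u}, (∀ᶠ γ in U, (g γ).rank < ρ) →
      ∃ x, ∀ᶠ γ in U, g γ = x := by
  intro ρ
  induction ρ using WellFoundedLT.induction with
  | ind ρ ih =>
    intro hρ g hg
    have hmem : ∀ σ < κ.rank, σ.toZFSet ∈ κ := fun σ hσ => by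
      rw [← hU.isOrdinal.toZFSet_rank_eq]
      exact Ordinal.toZFSet_mem_toZFSet_iff.2 hσ
    obtain ⟨α, -, hα⟩ := hU.exists_const_of_mem (hmem ρ hρ)
      (g := fun γ => (g γ).rank.toZFSet) (hg.mono fun γ h => Ordinal.toZFSet_mem_toZFSet_iff.2 h)
    obtain ⟨γ₀, h1, h2⟩ := (hα.and hg).exists
    set σ := (g γ₀).rank with hσ
    have hrank : ∀ᶠ γ in U, (g γ).rank = σ := by
      filter_upwards [hα] with γ hγ
      exact Ordinal.toZFSet_injective (hγ.trans h1.symm)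
    let S : ZFSet := ZFSet.sep (fun y => ∀ᶠ γ in U, y ∈ g γ) (ZFSet.vonNeumann σ)
    refine ⟨S, ?_⟩
    by_contra hne
    rw [← Ultrafilter.eventually_not] at hne
    have hex : ∀ᶠ γ in U, ∃ y, y.rank < σ ∧ ¬ (y ∈ g γ ↔ y ∈ S) := by
      filter_upwards [hne, hrank] with γ h3 h4
      by_contra hcon
      push Not at hcon
      apply h3
      ext y
      by_cases hy : y.rank < σ
      · have := hcon y hy
        tauto
      · refine iff_of_false (fun h => hy (h4 ▸ ZFSet.rank_lt_of_mem h)) fun h => hy ?_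
        exact ZFSet.mem_vonNeumann.1 (ZFSet.mem_sep.1 h).1
    classical
    let f : ZFSet → ZFSet := fun γ =>
      if h : ∃ y, y.rank < σ ∧ ¬ (y ∈ g γ ↔ y ∈ S) then h.choose else ∅
    have hf : ∀ᶠ γ in U, (f γ).rank < σ ∧ ¬ (f γ ∈ g γ ↔ f γ ∈ S) := by
      filter_upwards [hex] with γ hγ
      simp only [f, dif_pos hγ]
      exact hγ.choose_spec
    obtain ⟨y, hy⟩ := ih σ h2 (h2.trans hρ) f (hf.mono fun _ h => h.1)
    have hyS : ∀ᶠ γ in U, y.rank < σ ∧ ¬ (y ∈ g γ ↔ y ∈ S) := by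
      filter_upwards [hf, hy] with γ h3 h4
      rwa [h4] at h3
    obtain ⟨γ₁, h5, -⟩ := hyS.exists
    by_cases hyU : ∀ᶠ γ in U, y ∈ g γ
    · obtain ⟨γ, h6, h7⟩ := (hyU.and hyS).exists
      exact h7.2 (iff_of_true h6 (ZFSet.mem_sep.2 ⟨ZFSet.mem_vonNeumann.2 h5, hyU⟩))
    · obtain ⟨γ, h6, h7⟩ := ((Ultrafilter.eventually_not.2 hyU).and hyS).exists
      exact h7.2 (iff_of_false h6 fun h => hyU (ZFSet.mem_sep.1 h).2)

theorem exists_const_of_mem_of_rank_lt (hU : IsNormalUltrafilter κ U) {x : ZFSet.{u}}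
    (hx : x.rank < κ.rank) {g : ZFSet.{u} → ZFSet.{u}} (hg : ∀ᶠ γ in U, g γ ∈ x) :
    ∃ y, ∀ᶠ γ in U, g γ = y :=
  hU.exists_const_of_rank_lt _ hx g (hg.mono fun _ h => ZFSet.rank_lt_of_mem h)

/-- Elements of a transitive set that is a surjective image of some `γ ∈ κ` have rank
below `κ`. -/
theorem rank_lt_of_surjOn (hU : IsNormalUltrafilter κ U) {γ M : ZFSet.{u}} (hγ : γ ∈ κ)
    (hM : M.IsTransitive) {f : ZFSet.{u} → ZFSet.{u}} (hf : ∀ x ∈ M, ∃ i ∈ γ, f i = x)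
    {x : ZFSet.{u}} (hx : x ∈ M) : x.rank < κ.rank := by
  by_contra hle
  push Not at hle
  have hdown : ∀ x ∈ M, ∀ σ ≤ x.rank, ∃ y ∈ M, y.rank = σ := by
    intro x
    induction x using ZFSet.inductionOn with
    | h x ih =>
      intro hx σ hσ
      rcases hσ.eq_or_lt with rfl | hlt
      · exact ⟨x, hx, rfl⟩
      · obtain ⟨y, hy, hyσ⟩ := ZFSet.lt_rank_iff.1 hlt
        exact ih y hy (hM x hx hy) σ hyσ
  have hidx : ∀ δ : ZFSet.{u}, ∃ i, δ ∈ κ → i ∈ γ ∧ (f i).rank = δ.rank := fun δ => by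
    by_cases hδ : δ ∈ κ
    · obtain ⟨y, hy, hyr⟩ := hdown x hx δ.rank ((ZFSet.rank_lt_of_mem hδ).le.trans hle)
      obtain ⟨i, hi, rfl⟩ := hf y hy
      exact ⟨i, fun _ => ⟨hi, hyr⟩⟩
    · exact ⟨∅, fun h => absurd h hδ⟩
  choose idx hidx using hidx
  obtain ⟨i, -, hi⟩ := hU.exists_const_of_mem hγ (hU.mem.mono fun δ hδ => (hidx δ hδ).1)
  have hr : ∀ᶠ δ : ZFSet.{u} in U, (f i).rank = δ.rank := by
    filter_upwards [hi, hU.mem] with δ h1 h2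
    exact h1 ▸ (hidx δ h2).2
  obtain ⟨δ₀, h1, h2⟩ := (hr.and hU.mem).exists
  obtain ⟨δ, h3, h4⟩ := (hr.and (hU.tail δ₀ h2)).exists
  exact (ZFSet.rank_lt_of_mem h4).ne (h1.symm.trans h3)

end IsNormalUltrafilter

/-! ### The transitive collapse of the ultrapower of the universe -/

/-- `c` maps every function to the transitive collapse of its class in the ultrapower of the
universe by `U`. -/
def IsCollapse (U : Ultrafilter ZFSet.{u}) (c : (ZFSet.{u} → ZFSet.{u}) → ZFSet.{u}) : Prop :=
  ∀ g z, z ∈ c g ↔ ∃ h : ZFSet.{u} → ZFSet.{u}, (∀ᶠ γ in U, h γ ∈ g γ) ∧ c h = z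

theorem IsNormalUltrafilter.exists_isCollapse {κ : ZFSet.{u}} {U : Ultrafilter ZFSet.{u}}
    (hU : IsNormalUltrafilter κ U) : ∃ c, IsCollapse U c := by
  classical
  let E : (ZFSet.{u} → ZFSet.{u}) → (ZFSet.{u} → ZFSet.{u}) → Prop :=
    fun h g => ∀ᶠ γ in U, h γ ∈ g γ
  have wf : WellFounded E := by
    rw [wellFounded_iff_isEmpty_descending_chain]
    refine ⟨fun ⟨x, hx⟩ => ?_⟩
    have := hU.countable
    obtain ⟨γ, hγ⟩ := (eventually_countable_forall.2 hx).exists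
    exact (wellFounded_iff_isEmpty_descending_chain.1 ZFSet.mem_wf).false
      ⟨fun n => x n γ, hγ⟩
  let c : (ZFSet.{u} → ZFSet.{u}) → ZFSet.{u} := wf.fix fun g rec =>
    if H : Small.{u} {z | ∃ h, ∃ hE : E h g, rec h hE = z} then
      ZFSet.range (Subtype.val : {z | ∃ h, ∃ hE : E h g, rec h hE = z} → ZFSet.{u})
    else ∅
  have hc : ∀ g, c g = if H : Small.{u} {z | ∃ h, ∃ _ : E h g, c h = z} then
      ZFSet.range (Subtype.val : {z | ∃ h, ∃ _ : E h g, c h = z} → ZFSet.{u}) else ∅ :=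
    fun g => wf.fix_eq _ g
  have hcongr : ∀ g g' : ZFSet.{u} → ZFSet.{u}, (∀ᶠ γ in U, g γ = g' γ) → c g = c g' := by
    intro g g' hgg
    have hset : {z | ∃ h, ∃ _ : E h g, c h = z} = {z | ∃ h, ∃ _ : E h g', c h = z} := by
      have : ∀ h, E h g ↔ E h g' := fun h =>
        Filter.eventually_congr (hgg.mono fun γ hγ => by rw [hγ])
      simp only [this]
    have aux : ∀ S S' : Set ZFSet.{u}, S = S' →
        (if _ : Small.{u} S then ZFSet.range (Subtype.val : S → ZFSet.{u}) else ∅) =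
          if _ : Small.{u} S' then ZFSet.range (Subtype.val : S' → ZFSet.{u}) else ∅ := by
      rintro S _ rfl
      rfl
    rw [hc g, hc g']
    exact aux _ _ hset
  have hsmall : ∀ g, Small.{u} {z | ∃ h, ∃ _ : E h g, c h = z} := by
    intro g
    let F : ((γ : κ) → (insert ∅ (g γ) : ZFSet.{u})) → ZFSet.{u} := fun h =>
      c fun γ => if hγ : γ ∈ κ then (h ⟨γ, hγ⟩ : ZFSet.{u}) else ∅
    have hF : Small.{u} (Set.range F) := inferInstance
    suffices hsub : {z | ∃ h, ∃ _ : E h g, c h = z} ⊆ Set.range F from small_subset hsub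
    rintro _ ⟨h, hE, rfl⟩
    refine ⟨fun γ => if hγ : h γ ∈ g γ then ⟨h γ, ZFSet.mem_insert_of_mem _ hγ⟩ else
      ⟨∅, ZFSet.mem_insert _ _⟩, hcongr _ _ ?_⟩
    filter_upwards [hE, hU.mem] with γ h1 h2
    simp [h1, h2]
  refine ⟨c, fun g z => ?_⟩
  rw [hc g, dif_pos (hsmall g), ZFSet.mem_range]
  constructor
  · rintro ⟨⟨_, h, hE, rfl⟩, rfl⟩
    exact ⟨h, hE, rfl⟩
  · rintro ⟨h, hE, rfl⟩
    exact ⟨⟨_, h, hE, rfl⟩, rfl⟩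

namespace IsCollapse

variable {κ : ZFSet.{u}} {U : Ultrafilter ZFSet.{u}} {c : (ZFSet.{u} → ZFSet.{u}) → ZFSet.{u}}

theorem congr (hc : IsCollapse U c) {g g' : ZFSet.{u} → ZFSet.{u}}
    (h : ∀ᶠ γ in U, g γ = g' γ) : c g = c g' := by
  ext z
  rw [hc, hc]
  have : ∀ f : ZFSet.{u} → ZFSet.{u}, (∀ᶠ γ in U, f γ ∈ g γ) ↔ ∀ᶠ γ in U, f γ ∈ g' γ := fun f =>
    Filter.eventually_congr (h.mono fun γ hγ => by rw [hγ])
  simp only [this]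

theorem exists_mem_of_ne {g g' : ZFSet.{u} → ZFSet.{u}}
    (h : ¬ ∀ᶠ γ in U, g γ = g' γ) :
    ∃ f : ZFSet.{u} → ZFSet.{u}, ((∀ᶠ γ in U, f γ ∈ g γ) ∧ ∀ᶠ γ in U, f γ ∉ g' γ) ∨
      ((∀ᶠ γ in U, f γ ∈ g' γ) ∧ ∀ᶠ γ in U, f γ ∉ g γ) := by
  classical
  have h' : ∀ γ, ∃ y, g γ ≠ g' γ → (y ∈ g γ ∧ y ∉ g' γ) ∨ (y ∈ g' γ ∧ y ∉ g γ) := by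
    intro γ
    by_contra hcon
    push Not at hcon
    refine (hcon ∅).1 (ZFSet.ext fun y => ?_)
    have := hcon y
    tauto
  choose f hf using h'
  refine ⟨f, ?_⟩
  rw [← Filter.eventually_and, ← Filter.eventually_and, ← Ultrafilter.eventually_or]
  exact (Ultrafilter.eventually_not.2 h).mono hf

theorem eq_iff (hc : IsCollapse U c) {g g' : ZFSet.{u} → ZFSet.{u}} :
    c g = c g' ↔ ∀ᶠ γ in U, g γ = g' γ := by
  refine ⟨fun h => ?_, hc.congr⟩
  obtain ⟨x, hx⟩ : ∃ x, x = c g := ⟨_, rfl⟩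
  induction x using ZFSet.inductionOn generalizing g g' with
  | h x ih =>
    subst hx
    by_contra hne
    obtain ⟨f, ⟨h1, h2⟩ | ⟨h1, h2⟩⟩ := exists_mem_of_ne hne
    · have hm : c f ∈ c g := (hc _ _).2 ⟨f, h1, rfl⟩
      obtain ⟨f', h3, h4⟩ := (hc _ _).1 (h ▸ hm)
      obtain ⟨γ, h5, h6, h7⟩ := ((ih _ hm h4.symm rfl).and (h2.and h3)).exists
      exact h6 (h5 ▸ h7)
    · have hm : c f ∈ c g := h ▸ (hc _ _).2 ⟨f, h1, rfl⟩
      obtain ⟨f', h3, h4⟩ := (hc _ _).1 hm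
      obtain ⟨γ, h5, h6, h7⟩ := ((ih _ hm h4.symm rfl).and (h2.and h3)).exists
      exact h6 (h5 ▸ h7)

theorem mem_iff (hc : IsCollapse U c) {f g : ZFSet.{u} → ZFSet.{u}} :
    c f ∈ c g ↔ ∀ᶠ γ in U, f γ ∈ g γ := by
  rw [hc]
  refine ⟨?_, fun h => ⟨f, h, rfl⟩⟩
  rintro ⟨h, h1, h2⟩
  filter_upwards [h1, hc.eq_iff.1 h2] with γ h3 h4
  rwa [← h4]

theorem isTransitive (hc : IsCollapse U c) {N : ZFSet.{u} → ZFSet.{u}}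
    (hN : ∀ᶠ γ in U, (N γ).IsTransitive) : (c N).IsTransitive := by
  intro y hy z hz
  obtain ⟨g, hg, rfl⟩ := (hc _ _).1 hy
  obtain ⟨f, hf, rfl⟩ := (hc _ _).1 hz
  rw [hc.mem_iff]
  filter_upwards [hN, hg, hf] with γ h1 h2 h3
  exact h1 _ h2 h3

/-- Łoś's theorem. -/
theorem sat_iff (hc : IsCollapse U c) (N : ZFSet.{u} → ZFSet.{u}) {β : Type} {n : ℕ}
    (φ : SetLang.BoundedFormula β n) (v : β → ZFSet.{u} → ZFSet.{u})
    (xs : Fin n → ZFSet.{u} → ZFSet.{u}) :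
    Sat (c N).toSet φ (fun i => c (v i)) (fun i => c (xs i)) ↔
      ∀ᶠ γ in U, Sat (N γ).toSet φ (fun i => v i γ) (fun i => xs i γ) := by
  have key : ∀ {m : ℕ} (ys : Fin m → ZFSet.{u} → ZFSet.{u}) (t : β ⊕ Fin m),
      Sum.elim (fun i => c (v i)) (fun i => c (ys i)) t =
        c fun γ => Sum.elim (fun i => v i γ) (fun i => ys i γ) t := by
    rintro m ys (t | t) <;> rfl
  induction φ with
  | falsum =>
    simp only [Sat, Filter.eventually_const]
  | equal s t =>
    simp only [Sat, key, hc.eq_iff]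
  | rel R ts =>
    cases R
    simp only [Sat, key, hc.mem_iff]
  | imp φ ψ ihφ ihψ => simp only [Sat, ihφ, ihψ, Ultrafilter.eventually_imp]
  | all φ ih =>
    simp only [Sat]
    have hsnoc : ∀ f : ZFSet.{u} → ZFSet.{u},
        Sat (c N).toSet φ (fun i => c (v i)) (Fin.snoc (fun i => c (xs i)) (c f)) ↔
          ∀ᶠ γ in U, Sat (N γ).toSet φ (fun i => v i γ) (Fin.snoc (fun i => xs i γ) (f γ)) := by
      intro f
      have e1 : ∀ {X : Type (u + 1)} (a : (ZFSet.{u} → ZFSet.{u}) → X),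
          (fun i => a ((Fin.snoc xs f : Fin _ → ZFSet.{u} → ZFSet.{u}) i)) =
            (Fin.snoc (fun i => a (xs i)) (a f) : Fin _ → X) := by
        intro X a
        funext i
        refine Fin.lastCases ?_ (fun i => ?_) i <;> simp
      rw [← e1 c]
      refine (ih (Fin.snoc xs f)).trans (Filter.eventually_congr
        (Filter.Eventually.of_forall fun γ => ?_))
      rw [e1 fun g => g γ]
    constructor
    · intro h
      by_contra hcon
      rw [← Ultrafilter.eventually_not] at hcon
      have hex : ∀ γ, ∃ x, (¬ ∀ x ∈ (N γ).toSet, Sat (N γ).toSet φ (fun i => v i γ)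
          (Fin.snoc (fun i => xs i γ) x)) → x ∈ N γ ∧ ¬ Sat (N γ).toSet φ (fun i => v i γ)
          (Fin.snoc (fun i => xs i γ) x) := by
        intro γ
        by_contra hno
        push Not at hno
        obtain ⟨x, h1, h2⟩ := (hno ∅).1
        exact h2 ((hno x).2 h1)
      choose f hf using hex
      have h1 := (hsnoc f).1 (h _ (hc.mem_iff.2 (hcon.mono fun γ hγ => (hf γ hγ).1)))
      obtain ⟨γ, h2, h3⟩ := (h1.and hcon).exists
      exact (hf γ h3).2 h2
    · intro h x hx
      obtain ⟨f, hf, rfl⟩ := (hc _ _).1 hx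
      rw [hsnoc]
      filter_upwards [h, hf] with γ h1 h2
      exact h1 _ h2

theorem formula_sat_iff (hc : IsCollapse U c) (N : ZFSet.{u} → ZFSet.{u}) {β : Type}
    (φ : SetLang.Formula β) (v : β → ZFSet.{u} → ZFSet.{u}) :
    Sat (c N).toSet φ (fun i => c (v i)) Fin.elim0 ↔
      ∀ᶠ γ in U, Sat (N γ).toSet φ (fun i => v i γ) Fin.elim0 := by
  have h := hc.sat_iff N φ v Fin.elim0
  simpa only [Subsingleton.elim _ (Fin.elim0 : Fin 0 → ZFSet.{u})] using h

theorem unorderedPair (hc : IsCollapse U c) (f g : ZFSet.{u} → ZFSet.{u}) :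
    c (fun γ => {f γ, g γ}) = {c f, c g} := by
  ext z
  rw [hc, ZFSet.mem_pair]
  simp only [ZFSet.mem_pair, Ultrafilter.eventually_or]
  constructor
  · rintro ⟨h, h1 | h1, rfl⟩
    · exact Or.inl (hc.eq_iff.2 h1)
    · exact Or.inr (hc.eq_iff.2 h1)
  · rintro (rfl | rfl)
    · exact ⟨f, Or.inl (Filter.Eventually.of_forall fun _ => rfl), rfl⟩
    · exact ⟨g, Or.inr (Filter.Eventually.of_forall fun _ => rfl), rfl⟩

theorem pair (hc : IsCollapse U c) (f g : ZFSet.{u} → ZFSet.{u}) :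
    c (fun γ => ZFSet.pair (f γ) (g γ)) = ZFSet.pair (c f) (c g) := by
  have hpair : ∀ a b : ZFSet.{u}, ZFSet.pair a b = {{a, a}, {a, b}} := fun a b => by
    rw [ZFSet.pair_eq_singleton, ZFSet.pair]
  simp only [hpair]
  rw [hc.unorderedPair (fun γ => {f γ, f γ}) fun γ => {f γ, g γ}, hc.unorderedPair,
    hc.unorderedPair]

theorem const (hc : IsCollapse U c) (hU : IsNormalUltrafilter κ U) {x : ZFSet.{u}}
    (hx : x.rank < κ.rank) : c (fun _ => x) = x := by
  induction x using ZFSet.inductionOn with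
  | h x ih =>
    ext z
    rw [hc]
    constructor
    · rintro ⟨h, h1, rfl⟩
      obtain ⟨y, hy⟩ := hU.exists_const_of_mem_of_rank_lt hx h1
      obtain ⟨γ, h2, h3⟩ := (h1.and hy).exists
      have hyx : y ∈ x := h3 ▸ h2
      rwa [hc.congr hy, ih y hyx ((ZFSet.rank_lt_of_mem hyx).trans hx)]
    · exact fun hz => ⟨fun _ => z, Filter.Eventually.of_forall fun _ => hz,
        ih z hz ((ZFSet.rank_lt_of_mem hz).trans hx)⟩

theorem const_of_mem (hc : IsCollapse U c) (hU : IsNormalUltrafilter κ U) {α : ZFSet.{u}}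
    (hα : α ∈ κ) : c (fun _ => α) = α :=
  hc.const hU (ZFSet.rank_lt_of_mem hα)

theorem diagonal_eq (hc : IsCollapse U c) (hU : IsNormalUltrafilter κ U) :
    c (fun γ => γ) = κ := by
  ext z
  rw [hc]
  constructor
  · rintro ⟨h, h1, rfl⟩
    obtain ⟨α, hα, h2⟩ := hU.exists_mem_const h1
    rwa [hc.congr h2, hc.const_of_mem hU hα]
  · exact fun hz => ⟨fun _ => z, hU.tail z hz, hc.const_of_mem hU hz⟩

end IsCollapse

/-! ### The normal ultrafilter derived from a measurability embedding -/

section MeasEmb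

variable {κ : ZFSet.{u}}

/-- The atomic formula `a ∈ b`. -/
def memFormula {β : Type} {m : ℕ} (a b : β ⊕ Fin m) : SetLang.BoundedFormula β m :=
  .rel memRel.mem ![.var a, .var b]

@[simp]
theorem sat_memFormula {X : Set ZFSet.{u}} {β : Type} {m : ℕ} (a b : β ⊕ Fin m)
    (v : β → ZFSet.{u}) (xs : Fin m → ZFSet.{u}) :
    Sat X (memFormula a b) v xs ↔ Sum.elim v xs a ∈ Sum.elim v xs b :=
  Iff.rfl

/-- The atomic formula `a = b`. -/
def eqFormula {β : Type} {m : ℕ} (a b : β ⊕ Fin m) : SetLang.BoundedFormula β m :=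
  .equal (.var a) (.var b)

@[simp]
theorem sat_eqFormula {X : Set ZFSet.{u}} {β : Type} {m : ℕ} (a b : β ⊕ Fin m)
    (v : β → ZFSet.{u}) (xs : Fin m → ZFSet.{u}) :
    Sat X (eqFormula a b) v xs ↔ Sum.elim v xs a = Sum.elim v xs b :=
  Iff.rfl

theorem ClassEmb.sat_iff {M N : Set ZFSet.{u}} (e : ClassEmb M N) {n : ℕ}
    (φ : SetLang.Formula (Fin n)) {v : Fin n → ZFSet.{u}} (hv : ∀ i, v i ∈ M) :
    Sat M φ v Fin.elim0 ↔ Sat N φ (fun i => e.j (v i)) Fin.elim0 := by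
  have := e.elem φ v hv
  rwa [formula_realize_iff_sat, formula_realize_iff_sat] at this

namespace MeasEmb

theorem sat (E : MeasEmb κ) {n : ℕ} (φ : SetLang.Formula (Fin n)) {v : Fin n → ZFSet.{u}}
    (h : Sat V φ v Fin.elim0) : Sat E.M φ (fun i => E.e.j (v i)) Fin.elim0 :=
  (E.e.sat_iff φ fun _ => Set.mem_univ _).1 h

theorem self_mem (E : MeasEmb κ) : κ ∈ E.M :=
  E.trans _ (E.e.maps κ (Set.mem_univ _)) _ E.crit.2.1

theorem mem_of_mem_s10 (E : MeasEmb κ) {x y : ZFSet.{u}} (h : y ∈ E.e.j x) : y ∈ E.M :=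
  E.trans _ (E.e.maps x (Set.mem_univ _)) _ h

theorem j_eq (E : MeasEmb κ) {α : ZFSet.{u}} (h : α ∈ κ) : E.e.j α = α :=
  E.crit.2.2 α (E.crit.1.mem h) h

theorem mem_of_inter (E : MeasEmb κ) {x y z w : ZFSet.{u}} (h : ∀ w ∈ x, w ∈ y → w ∈ z)
    (hx : w ∈ E.e.j x) (hy : w ∈ E.e.j y) : w ∈ E.e.j z := by
  let φ : SetLang.Formula (Fin 3) :=
    .all (.imp (memFormula (.inr 0) (.inl 0)) (.imp (memFormula (.inr 0) (.inl 1))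
      (memFormula (.inr 0) (.inl 2))))
  have := E.sat φ (v := ![x, y, z])
  simp [φ, Sat, Fin.snoc, V] at this
  exact this h w (E.mem_of_mem_s10 hx) hx hy

theorem mem_or_mem (E : MeasEmb κ) {x y z w : ZFSet.{u}} (h : ∀ w ∈ x, w ∉ y → w ∈ z)
    (hx : w ∈ E.e.j x) (hy : w ∉ E.e.j y) : w ∈ E.e.j z := by
  let φ : SetLang.Formula (Fin 3) :=
    .all (.imp (memFormula (.inr 0) (.inl 0)) (.imp (.imp (memFormula (.inr 0) (.inl 1)) .falsum)
      (memFormula (.inr 0) (.inl 2))))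
  have := E.sat φ (v := ![x, y, z])
  simp [φ, Sat, Fin.snoc, V] at this
  exact this h w (E.mem_of_mem_s10 hx) hx hy

theorem notMem_of_disjoint (E : MeasEmb κ) {x y w : ZFSet.{u}} (h : ∀ w ∈ x, w ∉ y)
    (hx : w ∈ E.e.j x) : w ∉ E.e.j y := by
  let φ : SetLang.Formula (Fin 2) :=
    .all (.imp (memFormula (.inr 0) (.inl 0)) (.imp (memFormula (.inr 0) (.inl 1)) .falsum))
  have := E.sat φ (v := ![x, y])
  simp [φ, Sat, Fin.snoc, V] at this
  exact this h w (E.mem_of_mem_s10 hx) hx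

/-- The ultrafilter of all classes `S` with `κ ∈ j(S ∩ κ)`. -/
noncomputable def ultrafilter (E : MeasEmb κ) : Ultrafilter ZFSet.{u} :=
  Ultrafilter.ofComplNotMemIff
    { sets := {S | κ ∈ E.e.j (ZFSet.sep (· ∈ S) κ)}
      univ_sets := by
        have : ZFSet.sep (· ∈ (Set.univ : Set ZFSet.{u})) κ = κ := by ext; simp
        rw [Set.mem_ofPred_eq, this]
        exact E.crit.2.1
      sets_of_superset := fun {S T} hS hST => E.mem_of_inter (fun w h _ => by
        rw [ZFSet.mem_sep] at h ⊢
        exact ⟨h.1, hST h.2⟩) hS hS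
      inter_sets := fun {S T} hS hT => E.mem_of_inter (fun w h h' => by
        rw [ZFSet.mem_sep] at h h' ⊢
        exact ⟨h.1, h.2, h'.2⟩) hS hT }
    fun S => by
      constructor
      · refine fun h => E.mem_or_mem (x := κ) (fun w hw hw' => ?_) E.crit.2.1 h
        rw [ZFSet.mem_sep] at hw' ⊢
        exact ⟨hw, by_contra fun h => hw' ⟨hw, h⟩⟩
      · refine fun h => E.notMem_of_disjoint (fun w hw hw' => ?_) h
        rw [ZFSet.mem_sep] at hw' hw
        exact hw'.2 hw.2

theorem eventually_iff (E : MeasEmb κ) {p : ZFSet.{u} → Prop} :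
    (∀ᶠ γ in E.ultrafilter, p γ) ↔ κ ∈ E.e.j (ZFSet.sep p κ) :=
  Iff.rfl

theorem eventually_mem (E : MeasEmb κ) : ∀ᶠ γ in E.ultrafilter, γ ∈ κ := by
  rw [E.eventually_iff]
  have : ZFSet.sep (· ∈ κ) κ = κ := by ext; simp
  rw [this]
  exact E.crit.2.1

theorem eventually_tail (E : MeasEmb κ) {α : ZFSet.{u}} (hα : α ∈ κ) :
    ∀ᶠ γ : ZFSet.{u} in E.ultrafilter, α ∈ γ := by
  rw [E.eventually_iff]
  let φ : SetLang.Formula (Fin 3) :=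
    .all (.imp (memFormula (.inr 0) (.inl 0)) (.imp (memFormula (.inl 1) (.inr 0))
      (memFormula (.inr 0) (.inl 2))))
  have := E.sat φ (v := ![κ, α, ZFSet.sep (α ∈ ·) κ])
  simp [φ, Sat, Fin.snoc, V, E.j_eq hα] at this
  exact this (fun _ h h' => ⟨h, h'⟩) κ E.self_mem E.crit.2.1 hα

theorem regressive (E : MeasEmb κ) {g : ZFSet.{u} → ZFSet.{u}}
    (hg : ∀ᶠ γ in E.ultrafilter, g γ ∈ γ) : ∃ α : ZFSet.{u}, ∀ᶠ γ in E.ultrafilter, g γ = α := by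
  rw [E.eventually_iff] at hg
  set X := ZFSet.sep (fun γ => g γ ∈ γ) κ
  let G : ZFSet.{u} := ZFSet.range fun γ : X => ({g γ, (γ : ZFSet.{u})} : ZFSet.{u})
  have hG : ∀ p, p ∈ G ↔ ∃ γ ∈ X, {g γ, γ} = p := fun p => by simp [G]
  obtain ⟨α, hα, p, hp, hαp, hκp⟩ : ∃ α ∈ κ, ∃ p ∈ E.e.j G, α ∈ p ∧ κ ∈ p := by
    let φ : SetLang.Formula (Fin 2) :=
      .all (.imp (memFormula (.inr 0) (.inl 0)) (.imp (.all (.imp (memFormula (.inr 1) (.inr 0))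
        (.all (.imp (memFormula (.inr 2) (.inl 1)) (.imp (memFormula (.inr 1) (.inr 2))
          (.imp (memFormula (.inr 0) (.inr 2)) .falsum)))))) .falsum))
    have := E.sat φ (v := ![X, G])
    simp [φ, Sat, Fin.snoc, V] at this
    obtain ⟨α, -, hα, p, -, hp, hαp, hκp⟩ := this (fun γ hγ =>
      ⟨g γ, (ZFSet.mem_sep.1 hγ).2, _, (hG _).2 ⟨γ, hγ, rfl⟩, by simp, by simp⟩)
      κ E.self_mem hg
    exact ⟨α, hα, p, hp, hαp, hκp⟩
  refine ⟨α, ?_⟩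
  rw [E.eventually_iff]
  let φ : SetLang.Formula (Fin 4) :=
    .all (.imp (memFormula (.inr 0) (.inl 0)) (.all (.imp (memFormula (.inr 1) (.inl 1))
      (.imp (memFormula (.inl 2) (.inr 1)) (.imp (memFormula (.inr 0) (.inr 1))
        (.imp (memFormula (.inl 2) (.inr 0)) (memFormula (.inr 0) (.inl 3))))))))
  have := E.sat φ (v := ![κ, G, α, ZFSet.sep (g · = α) κ])
  simp [φ, Sat, Fin.snoc, V, E.j_eq hα] at this
  refine this ?_ κ E.self_mem E.crit.2.1 p (E.mem_of_mem_s10 hp) hp hαp hκp hα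
  intro γ hγ p hp h1 h2 h3
  obtain ⟨δ, hδ, rfl⟩ := (hG p).1 hp
  have h4 := (ZFSet.mem_sep.1 hδ).2
  rw [ZFSet.mem_pair] at h1 h2
  refine ⟨hγ, ?_⟩
  rcases h1 with rfl | rfl <;> rcases h2 with rfl | rfl
  · exact absurd h3 (ZFSet.mem_irrefl _)
  · rfl
  · exact absurd h3 (ZFSet.mem_asymm h4)
  · exact absurd h3 (ZFSet.mem_irrefl _)

theorem exists_mem_isLimit (E : MeasEmb κ) :
    ∃ γ ∈ κ, γ ≠ ∅ ∧ ∀ β ∈ γ, ∃ z ∈ γ, β ∈ z := by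
  by_contra hcon
  push Not at hcon
  have hmax : κ = ∅ ∨ ∃ β ∈ κ, ∀ z ∈ κ, z ≠ β → z ∈ β := by
    let φ : SetLang.Formula (Fin 1) :=
      .all (.imp (memFormula (.inr 0) (.inl 0)) (.imp
        (.all (.imp (memFormula (.inr 1) (.inr 0)) (.imp
          (.all (.imp (memFormula (.inr 2) (.inr 0)) (.imp
            (.imp (eqFormula (.inr 2) (.inr 1)) .falsum) (memFormula (.inr 2) (.inr 1)))))
          .falsum)))
        (.all (.imp (memFormula (.inr 1) (.inr 0)) .falsum))))
    have := E.sat φ (v := ![κ])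
    simp [φ, Sat, Fin.snoc, V] at this
    by_contra hno
    push Not at hno
    obtain ⟨hne, hno⟩ := hno
    have hκ : ∀ y ∈ κ, y ∈ E.M := fun y hy => E.trans _ E.self_mem y hy
    obtain ⟨y, hy⟩ := (ZFSet.eq_empty_or_nonempty _).resolve_left hne
    refine this ?_ κ E.self_mem E.crit.2.1 ?_ y (hκ y hy) hy
    · intro γ hγ h1 y hy
      obtain ⟨β, hβ, h2⟩ := hcon γ hγ (by rintro rfl; exact ZFSet.notMem_empty _ hy)
      obtain ⟨z, hz, h3, h4⟩ := h1 β hβ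
      have hγo := E.crit.1.mem hγ
      rcases (hγo.mem hz).mem_trichotomous (hγo.mem hβ) with h | h | h
      · exact h4 h
      · exact h3 h
      · exact h2 z hz h
    · intro β _ hβ
      obtain ⟨z, hz, h1, h2⟩ := hno β hβ
      exact ⟨z, hκ z hz, hz, h1, h2⟩
  rcases hmax with rfl | ⟨β, hβ, h⟩
  · exact E.notMem_of_disjoint (x := ∅) (y := ∅) (by simp) E.crit.2.1 E.crit.2.1
  · let φ : SetLang.Formula (Fin 2) :=
      .all (.imp (memFormula (.inr 0) (.inl 0)) (.imp
        (.imp (eqFormula (.inr 0) (.inl 1)) .falsum) (memFormula (.inr 0) (.inl 1))))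
    have := E.sat φ (v := ![κ, β])
    simp [φ, Sat, Fin.snoc, V, E.j_eq hβ] at this
    refine ZFSet.mem_asymm hβ (this h κ E.self_mem E.crit.2.1 ?_)
    rintro rfl
    exact ZFSet.mem_irrefl _ hβ

theorem countableInterFilter (E : MeasEmb κ) :
    CountableInterFilter (E.ultrafilter : Filter ZFSet.{u}) := by
  classical
  obtain ⟨γ₀, hγ₀, hne, hlim⟩ := E.exists_mem_isLimit
  obtain ⟨y₀, hy₀⟩ := (ZFSet.eq_empty_or_nonempty _).resolve_left hne
  choose! s hs using hlim
  let h : ℕ → ZFSet.{u} := fun n => s^[n] y₀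
  have hsucc : ∀ n, h (n + 1) = s (h n) := fun n => Function.iterate_succ_apply' s n y₀
  have hh : ∀ n, h n ∈ γ₀ := fun n => by
    induction n with
    | zero => exact hy₀
    | succ n ih =>
      rw [hsucc]
      exact (hs _ ih).1
  have hmono : StrictMono fun n => (h n).rank := strictMono_nat_of_lt_succ fun n => by
    rw [hsucc]
    exact ZFSet.rank_lt_of_mem (hs _ (hh n)).2
  have hinj : Function.Injective h := fun m n hmn => hmono.injective (congrArg ZFSet.rank hmn)
  refine ⟨fun S hS hmem => ?_⟩
  rcases S.eq_empty_or_nonempty with rfl | hSne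
  · simp
  obtain ⟨A, rfl⟩ := hS.exists_eq_range hSne
  have hA : ∀ n, ∀ᶠ γ in E.ultrafilter, γ ∈ A n := fun n => hmem _ ⟨n, rfl⟩
  by_contra hcon
  have hcon' : ∀ᶠ γ in E.ultrafilter, ∃ n, γ ∉ A n := by
    filter_upwards [Ultrafilter.compl_mem_iff_notMem.2 hcon] with γ hγ
    simpa using hγ
  let g : ZFSet.{u} → ZFSet.{u} := fun γ => if hn : ∃ n, γ ∉ A n then h hn.choose else ∅
  have hg : ∀ᶠ γ in E.ultrafilter, ∃ n, γ ∉ A n ∧ g γ = h n := by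
    filter_upwards [hcon'] with γ hγ
    exact ⟨_, hγ.choose_spec, dif_pos hγ⟩
  obtain ⟨α, hα⟩ := E.regressive (g := g) (by
    filter_upwards [hg, E.eventually_tail hγ₀, E.eventually_mem] with γ ⟨n, _, h2⟩ h3 h4
    rw [h2]
    exact (E.crit.1.mem h4).mem_trans (hh n) h3)
  obtain ⟨γ, ⟨n, -, h2⟩, h3⟩ := (hg.and hα).exists
  obtain ⟨γ', ⟨⟨m, h4, h5⟩, h6⟩, h7⟩ := ((hg.and hα).and (hA n)).exists
  have : m = n := hinj (by rw [← h5, ← h2, h6, h3])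
  exact h4 (this ▸ h7)

theorem isNormalUltrafilter (E : MeasEmb κ) : IsNormalUltrafilter κ E.ultrafilter where
  isOrdinal := E.crit.1
  mem := E.eventually_mem
  tail _ := E.eventually_tail
  regressive _ := E.regressive
  countable := E.countableInterFilter

end MeasEmb

end MeasEmb

/-! ### Counterexamples to the weakly compact Laver diamond -/

/-- `j` is an elementary embedding of `M` into `N`. -/
def IsElementary (M N : ZFSet.{u}) (j : ZFSet.{u} → ZFSet.{u}) : Prop :=
  (∀ x ∈ M, j x ∈ N) ∧ ∀ {n : ℕ} (φ : SetLang.Formula (Fin n)) (v : Fin n → ZFSet.{u}),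
    (∀ i, v i ∈ M) →
      (Sat M.toSet φ v Fin.elim0 ↔ Sat N.toSet φ (fun i => j (v i)) Fin.elim0)

/-- Some embedding of `M` into a transitive set with critical point `γ` maps `ℓ` to a function
with value `A` at `γ`. -/
def HasEmbedding (ℓ γ A M : ZFSet.{u}) : Prop :=
  ∃ N : ZFSet.{u}, N.IsTransitive ∧ ∃ e : ClassEmb M.toSet N.toSet,
    CritPt e.j γ ∧ ZFSet.pair γ A ∈ e.j ℓ

theorem hasEmbedding_iff {ℓ γ A M : ZFSet.{u}} :
    HasEmbedding ℓ γ A M ↔ ∃ (N : ZFSet.{u}) (j : ZFSet.{u} → ZFSet.{u}),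
      N.IsTransitive ∧ IsElementary M N j ∧ CritPt j γ ∧ ZFSet.pair γ A ∈ j ℓ := by
  constructor
  · rintro ⟨N, hN, e, h1, h2⟩
    exact ⟨N, e.j, hN, ⟨e.maps, fun φ _ hv => e.sat_iff φ hv⟩, h1, h2⟩
  · rintro ⟨N, j, hN, hj, h1, h2⟩
    refine ⟨N, hN, ⟨j, hj.1, fun φ v hv => ?_⟩, h1, h2⟩
    rw [formula_realize_iff_sat, formula_realize_iff_sat]
    exact hj.2 φ v hv

/-- `M` is a transitive set enumerated by `f` along `γ`, containing `γ`, `A` and `ℓ`, without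
an embedding with critical point `γ` along which `ℓ` anticipates `A`. -/
structure IsCounterexample (ℓ γ A M : ZFSet.{u}) (f : ZFSet.{u} → ZFSet.{u}) : Prop where
  isTransitive : M.IsTransitive
  maps : ∀ α ∈ γ, f α ∈ M
  surj : ∀ x ∈ M, ∃ α ∈ γ, f α = x
  self_mem : γ ∈ M
  val_mem : A ∈ M
  fun_mem : ℓ ∈ M
  not_hasEmbedding : ¬ HasEmbedding ℓ γ A M

/-- The graph of the restriction of `F` to `γ`. -/
noncomputable def graphOn (F : ZFSet.{u} → ZFSet.{u}) (γ : ZFSet.{u}) : ZFSet.{u} :=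
  ZFSet.range fun β : γ => ZFSet.pair β (F β)

theorem mem_graphOn {F : ZFSet.{u} → ZFSet.{u}} {γ p : ZFSet.{u}} :
    p ∈ graphOn F γ ↔ ∃ β ∈ γ, ZFSet.pair β (F β) = p := by
  simp [graphOn]

/-- There is a class function anticipating, at each `γ`, a counterexample to its own restriction
to `γ`, if there is any. -/
theorem exists_anticipating : ∃ F : ZFSet.{u} → ZFSet.{u}, ∀ γ,
    (∃ M f, IsCounterexample (graphOn F γ) γ (F γ) M f) ∨
      (F γ = ∅ ∧ ¬ ∃ A M f, IsCounterexample (graphOn F γ) γ A M f) := by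
  classical
  let pick : ZFSet.{u} → ZFSet.{u} → ZFSet.{u} := fun ℓ γ =>
    if h : ∃ A M f, IsCounterexample ℓ γ A M f then h.choose else ∅
  let F : ZFSet.{u} → ZFSet.{u} := ZFSet.mem_wf.fix fun γ rec =>
    pick (ZFSet.range fun β : γ => ZFSet.pair β (rec β β.2)) γ
  have hF : ∀ γ, F γ = pick (graphOn F γ) γ := fun γ => ZFSet.mem_wf.fix_eq _ γ
  refine ⟨F, fun γ => ?_⟩
  by_cases h : ∃ A M f, IsCounterexample (graphOn F γ) γ A M f
  · left
    have : F γ = h.choose := (hF γ).trans (dif_pos h)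
    rw [this]
    exact h.choose_spec
  · right
    refine ⟨?_, h⟩
    exact (hF γ).trans (dif_neg h)

/-- The transitive collapse map of the class `X`. -/
noncomputable def collapse (X : Set ZFSet.{u}) : ZFSet.{u} → ZFSet.{u} :=
  ZFSet.mem_wf.fix fun x rec =>
    ZFSet.range fun y : ZFSet.sep (· ∈ X) x => rec y (ZFSet.mem_sep.1 y.2).1

theorem mem_collapse {X : Set ZFSet.{u}} {x z : ZFSet.{u}} :
    z ∈ collapse X x ↔ ∃ y ∈ x, y ∈ X ∧ collapse X y = z := by
  have : collapse X x = ZFSet.range fun y : ZFSet.sep (· ∈ X) x => collapse X y :=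
    ZFSet.mem_wf.fix_eq _ x
  rw [this]
  simp [and_assoc]

section Reflection

variable {κ : ZFSet.{u}} {U : Ultrafilter ZFSet.{u}}

theorem IsNormalUltrafilter.exists_const (hU : IsNormalUltrafilter κ U)
    {P : ZFSet.{u} → ZFSet.{u} → Prop} (h : ∀ᶠ γ in U, ∃ β ∈ γ, P γ β) :
    ∃ β ∈ κ, ∀ᶠ γ : ZFSet.{u} in U, β ∈ γ ∧ P γ β := by
  have h' : ∀ γ : ZFSet.{u}, ∃ β, (∃ β ∈ γ, P γ β) → β ∈ γ ∧ P γ β := fun γ => by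
    by_cases h : ∃ β ∈ γ, P γ β
    · obtain ⟨β, hβ⟩ := h
      exact ⟨β, fun _ => hβ⟩
    · exact ⟨∅, fun h' => absurd h' h⟩
  choose g hg using h'
  have hg' : ∀ᶠ γ in U, g γ ∈ γ ∧ P γ (g γ) := h.mono hg
  obtain ⟨β, hβ, hc⟩ := hU.exists_mem_const (hg'.mono fun _ h => h.1)
  refine ⟨β, hβ, ?_⟩
  filter_upwards [hg', hc] with γ h1 h2
  rwa [h2] at h1

theorem IsCollapse.graphOn {c : (ZFSet.{u} → ZFSet.{u}) → ZFSet.{u}} (hc : IsCollapse U c)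
    (hU : IsNormalUltrafilter κ U) {F : ZFSet.{u} → ZFSet.{u}}
    (hF : ∀ γ ∈ κ, (F γ).rank < κ.rank) : c (graphOn F) = LaverDiamond.graphOn F κ := by
  have hpair : ∀ β ∈ κ, c (fun _ => ZFSet.pair β (F β)) = ZFSet.pair β (F β) := fun β hβ => by
    rw [hc.pair (fun _ => β) fun _ => F β, hc.const_of_mem hU hβ, hc.const hU (hF β hβ)]
  ext z
  rw [hc, mem_graphOn]
  constructor
  · rintro ⟨h, h1, rfl⟩
    obtain ⟨β, hβ, h2⟩ := hU.exists_const (h1.mono fun γ hγ => mem_graphOn.1 hγ)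
    refine ⟨β, hβ, ?_⟩
    rw [← hpair β hβ]
    exact hc.congr (h2.mono fun γ hγ => hγ.2)
  · rintro ⟨β, hβ, rfl⟩
    refine ⟨fun _ => ZFSet.pair β (F β), ?_, hpair β hβ⟩
    filter_upwards [hU.tail β hβ] with γ hγ
    exact mem_graphOn.2 ⟨β, hγ, rfl⟩

/-- A counterexample at `κ` reflects to almost every `γ` below `κ`. -/
theorem IsCounterexample.eventually_exists (hU : IsNormalUltrafilter κ U)
    {F : ZFSet.{u} → ZFSet.{u}} (hF : ∀ γ ∈ κ, (F γ).rank < κ.rank) {A M : ZFSet.{u}}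
    {f : ZFSet.{u} → ZFSet.{u}} (h : IsCounterexample (graphOn F κ) κ A M f) :
    ∀ᶠ γ in U, ∃ A' M' f', IsCounterexample (graphOn F γ) γ A' M' f' := by
  obtain ⟨c, hc⟩ := hU.exists_isCollapse
  let X : ZFSet.{u} → Set ZFSet.{u} := fun γ => {y | ∃ β ∈ γ, f β = y}
  let π : ZFSet.{u} → ZFSet.{u} → ZFSet.{u} := fun γ => collapse (X γ)
  let T : ZFSet.{u} → ZFSet.{u} := fun γ => ZFSet.range fun β : γ => π γ (f β)
  have hT : ∀ {γ z}, z ∈ T γ ↔ ∃ β ∈ γ, π γ (f β) = z := by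
    intro γ z
    simp [T]
  have hTtrans : ∀ γ, (T γ).IsTransitive := by
    intro γ x hx z hz
    obtain ⟨β, -, rfl⟩ := hT.1 hx
    obtain ⟨_, -, ⟨β', hβ', rfl⟩, rfl⟩ := mem_collapse.1 hz
    exact hT.2 ⟨β', hβ', rfl⟩
  have hπ : ∀ x ∈ M, c (fun γ => π γ x) = x := by
    intro x
    induction x using ZFSet.inductionOn with
    | h x ih =>
      intro hx
      ext z
      rw [hc]
      constructor
      · rintro ⟨g, hg, rfl⟩
        obtain ⟨β, hβ, h2⟩ := hU.exists_const (P := fun γ β => f β ∈ x ∧ π γ (f β) = g γ)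
          (hg.mono fun γ hγ => by
            obtain ⟨_, h1, ⟨β, hβ, rfl⟩, h3⟩ := mem_collapse.1 hγ
            exact ⟨β, hβ, h1, h3⟩)
        obtain ⟨γ, -, h3, -⟩ := h2.exists
        have : c g = c fun γ => π γ (f β) := hc.congr (h2.mono fun γ hγ => hγ.2.2.symm)
        rwa [this, ih _ h3 (h.maps β hβ)]
      · intro hz
        have hzM := h.isTransitive x hx hz
        refine ⟨fun γ => π γ z, ?_, ih z hz hzM⟩
        obtain ⟨β, hβ, rfl⟩ := h.surj z hzM
        filter_upwards [hU.tail β hβ] with γ hγ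
        exact mem_collapse.2 ⟨_, hz, ⟨β, hγ, rfl⟩, rfl⟩
  have hcT : c T = M := by
    ext z
    rw [hc]
    constructor
    · rintro ⟨g, hg, rfl⟩
      obtain ⟨β, hβ, h2⟩ := hU.exists_const (hg.mono fun γ hγ => hT.1 hγ)
      have : c g = c fun γ => π γ (f β) := hc.congr (h2.mono fun γ hγ => hγ.2.symm)
      rw [this, hπ _ (h.maps β hβ)]
      exact h.maps β hβ
    · intro hz
      refine ⟨fun γ => π γ z, ?_, hπ z hz⟩
      obtain ⟨β, hβ, rfl⟩ := h.surj z hz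
      filter_upwards [hU.tail β hβ] with γ hγ
      exact hT.2 ⟨β, hγ, rfl⟩
  have hπT : ∀ x ∈ M, ∀ᶠ γ in U, π γ x ∈ T γ := fun x hx => by
    rw [← hc.mem_iff, hcT, hπ x hx]
    exact hx
  have hπκ : ∀ᶠ γ in U, π γ κ = γ := by
    rw [← hc.eq_iff, hπ κ h.self_mem, hc.diagonal_eq hU]
  have hπℓ : ∀ᶠ γ in U, π γ (graphOn F κ) = graphOn F γ := by
    rw [← hc.eq_iff, hπ _ h.fun_mem, ← hc.graphOn hU hF]
  have hπα : ∀ α ∈ κ, ∀ᶠ γ in U, π γ α = α := fun α hα => by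
    rw [← hc.eq_iff, hπ α (h.isTransitive κ h.self_mem hα), hc.const_of_mem hU hα]
  by_contra hcon
  have hemb : ∀ᶠ γ in U, HasEmbedding (graphOn F γ) γ (π γ A) (T γ) := by
    filter_upwards [Ultrafilter.eventually_not.2 hcon, hπκ, hπℓ, hπT _ h.self_mem,
      hπT _ h.fun_mem, hπT _ h.val_mem] with γ h1 h2 h3 h4 h5 h6
    by_contra h7
    rw [h2] at h4
    rw [h3] at h5
    exact h1 ⟨π γ A, T γ, fun β => π γ (f β), hTtrans γ, fun α hα => hT.2 ⟨α, hα, rfl⟩,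
      fun x hx => hT.1 hx, h4, h6, h5, h7⟩
  have hex : ∀ γ, ∃ (N : ZFSet.{u}) (j : ZFSet.{u} → ZFSet.{u}),
      HasEmbedding (graphOn F γ) γ (π γ A) (T γ) → N.IsTransitive ∧ IsElementary (T γ) N j ∧
        CritPt j γ ∧ ZFSet.pair γ (π γ A) ∈ j (graphOn F γ) := fun γ => by
    by_cases hγ : HasEmbedding (graphOn F γ) γ (π γ A) (T γ)
    · obtain ⟨N, j, hj⟩ := hasEmbedding_iff.1 hγ
      exact ⟨N, j, fun _ => hj⟩
    · exact ⟨∅, id, fun h => absurd h hγ⟩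
  choose N j hj using hex
  replace hj := hemb.mono hj
  refine h.not_hasEmbedding (hasEmbedding_iff.2 ⟨c N, fun x => c fun γ => j γ (π γ x),
    hc.isTransitive (hj.mono fun γ hγ => hγ.1), ⟨fun x hx => ?_, fun φ v hv => ?_⟩,
    ⟨hU.isOrdinal, ?_, fun α _ hα => ?_⟩, ?_⟩)
  · rw [hc.mem_iff]
    filter_upwards [hj, hπT x hx] with γ h1 h2
    exact h1.2.1.1 _ h2
  · rw [hc.formula_sat_iff N φ fun i γ => j γ (π γ (v i))]
    have hv' : v = fun i => c fun γ => π γ (v i) := funext fun i => (hπ _ (hv i)).symm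
    have hv'' : ∀ᶠ γ in U, ∀ i, π γ (v i) ∈ T γ := Filter.eventually_all.2 fun i => hπT _ (hv i)
    have := hc.formula_sat_iff T φ fun i γ => π γ (v i)
    rw [hcT, ← hv'] at this
    rw [this]
    refine Filter.eventually_congr ?_
    filter_upwards [hj, hv''] with γ h1 h2
    exact h1.2.1.2 φ _ h2
  · suffices c (fun γ => γ) ∈ c fun γ => j γ (π γ κ) by rwa [hc.diagonal_eq hU] at this
    rw [hc.mem_iff]
    filter_upwards [hj, hπκ] with γ h1 h2
    rw [h2]
    exact h1.2.2.1.2.1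
  · conv_rhs => rw [← hc.const_of_mem hU hα]
    rw [hc.eq_iff]
    filter_upwards [hj, hπα α hα, hU.tail α hα] with γ h1 h2 h3
    rw [h2, h1.2.2.1.2.2 α (hU.isOrdinal.mem hα) h3]
  · suffices c (fun γ => ZFSet.pair γ (π γ A)) ∈ c fun γ => j γ (π γ (graphOn F κ)) by
      rwa [hc.pair (fun γ => γ) fun γ => π γ A, hc.diagonal_eq hU, hπ A h.val_mem] at this
    rw [hc.mem_iff]
    filter_upwards [hj, hπℓ] with γ h1 h2
    rw [h2]
    exact h1.2.2.2

/-- It is impossible that `F γ` is a counterexample for almost all `γ`. -/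
theorem not_eventually_isCounterexample (hU : IsNormalUltrafilter κ U)
    {F : ZFSet.{u} → ZFSet.{u}} (hF : ∀ γ ∈ κ, (F γ).rank < κ.rank) :
    ¬ ∀ᶠ γ in U, ∃ M f, IsCounterexample (graphOn F γ) γ (F γ) M f := by
  intro hbad
  obtain ⟨c, hc⟩ := hU.exists_isCollapse
  have hex : ∀ γ, ∃ (M : ZFSet.{u}) (f : ZFSet.{u} → ZFSet.{u}),
      (∃ M f, IsCounterexample (graphOn F γ) γ (F γ) M f) →
        IsCounterexample (graphOn F γ) γ (F γ) M f := fun γ => by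
    by_cases hγ : ∃ M f, IsCounterexample (graphOn F γ) γ (F γ) M f
    · obtain ⟨M, f, h⟩ := hγ
      exact ⟨M, f, fun _ => h⟩
    · exact ⟨∅, id, fun h => absurd h hγ⟩
  choose M f hMf using hex
  replace hMf := hbad.mono hMf
  have hidx : ∀ γ x, ∃ i, (∃ i ∈ γ, f γ i = x) → i ∈ γ ∧ f γ i = x := fun γ x => by
    by_cases h : ∃ i ∈ γ, f γ i = x
    · obtain ⟨i, hi⟩ := h
      exact ⟨i, fun _ => hi⟩
    · exact ⟨∅, fun h' => absurd h' h⟩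
  choose idx hidx using hidx
  let k : ZFSet.{u} → ZFSet.{u} := fun α => c fun δ => f δ α
  have hk : ∀ α ∈ κ, k α ∈ c M := fun α hα => by
    rw [hc.mem_iff]
    filter_upwards [hMf, hU.tail α hα] with δ h1 h2
    exact h1.maps α h2
  have hkidx : ∀ g : ZFSet.{u} → ZFSet.{u}, (∀ᶠ γ in U, g γ ∈ M γ) →
      ∀ᶠ γ in U, k (idx γ (g γ)) = c g := by
    intro g hg
    have hg' : ∀ᶠ γ in U, idx γ (g γ) ∈ γ ∧ f γ (idx γ (g γ)) = g γ := by
      filter_upwards [hMf, hg] with γ h1 h2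
      exact hidx γ _ (h1.surj _ h2)
    obtain ⟨i, -, hi⟩ := hU.exists_mem_const (hg'.mono fun _ h => h.1)
    have : k i = c g := hc.congr (by
      filter_upwards [hg', hi] with γ h1 h2
      rw [← h2, h1.2])
    exact hi.mono fun γ hγ => by rw [hγ, this]
  have helem : ∀ᶠ γ in U, ∀ (n : ℕ) (φ : SetLang.Formula (Fin n)) (v : Fin n → ZFSet.{u}),
      (∀ i, v i ∈ γ) → (Sat (M γ).toSet φ (fun i => f γ (v i)) Fin.elim0 ↔
        Sat (c M).toSet φ (fun i => k (v i)) Fin.elim0) := by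
    have := hU.countable
    refine eventually_countable_forall.2 fun n => eventually_countable_forall.2 fun φ =>
      hU.diagonal_tuple fun v _ => ?_
    have := hc.formula_sat_iff M φ fun i δ => f δ (v i)
    by_cases h : Sat (c M).toSet φ (fun i => k (v i)) Fin.elim0
    · exact (this.1 h).mono fun γ hγ => iff_of_true hγ h
    · exact (Ultrafilter.eventually_not.2 (mt this.2 h)).mono fun γ hγ => iff_of_false hγ h
  have hfix : ∀ᶠ γ in U, ∀ α ∈ γ, k (idx γ α) = α := hU.diagonal fun α hα => by
    have := hkidx (fun _ => α) (by
      filter_upwards [hMf, hU.tail α hα] with γ h1 h2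
      exact h1.isTransitive γ h1.self_mem h2)
    rwa [hc.const_of_mem hU hα] at this
  have hself : ∀ᶠ γ in U, k (idx γ γ) = κ := by
    rw [← hc.diagonal_eq hU]
    exact hkidx _ (hMf.mono fun γ hγ => hγ.self_mem)
  have hgraph : ∀ᶠ γ in U, k (idx γ (graphOn F γ)) = graphOn F κ := by
    rw [← hc.graphOn hU hF]
    exact hkidx _ (hMf.mono fun γ hγ => hγ.fun_mem)
  obtain ⟨γ, h, hγ, h1, h2, h3, h4⟩ :=
    (hMf.and (hU.mem.and (helem.and (hfix.and (hself.and hgraph))))).exists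
  have hidx' : ∀ x ∈ M γ, idx γ x ∈ γ ∧ f γ (idx γ x) = x := fun x hx => hidx γ x (h.surj x hx)
  have htrans : (c M).IsTransitive := hc.isTransitive (hMf.mono fun δ hδ => hδ.isTransitive)
  refine h.not_hasEmbedding (hasEmbedding_iff.2 ⟨c M, fun x => k (idx γ x), htrans,
    ⟨fun x hx => hk _ (hU.isOrdinal.mem_trans (hidx' x hx).1 hγ), fun φ v hv => ?_⟩,
    ⟨hU.isOrdinal.mem hγ, ?_, fun α _ hα => h2 α hα⟩, ?_⟩)
  · rw [← h1 _ φ _ fun i => (hidx' _ (hv i)).1]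
    simp only [fun i => (hidx' _ (hv i)).2]
  · change γ ∈ k (idx γ γ)
    rwa [h3]
  · change ZFSet.pair γ (F γ) ∈ k (idx γ (graphOn F γ))
    rw [h4]
    exact mem_graphOn.2 ⟨γ, hγ, rfl⟩

end Reflection

theorem IsNormalUltrafilter.lDwc {κ : ZFSet.{u}} {U : Ultrafilter ZFSet.{u}}
    (hU : IsNormalUltrafilter κ U) : LDwc κ := by
  classical
  obtain ⟨F, hF⟩ := exists_anticipating.{u}
  have hrank : ∀ γ ∈ κ, (F γ).rank < κ.rank := fun γ hγ => by
    obtain ⟨M, f, h⟩ | ⟨h, -⟩ := hF γ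
    · exact hU.rank_lt_of_surjOn hγ h.isTransitive h.surj h.val_mem
    · rw [h, ZFSet.rank_empty]
      exact bot_le.trans_lt (ZFSet.rank_lt_of_mem hγ)
  refine ⟨graphOn F κ, ⟨fun p hp => ?_, fun γ A B hA hB => ?_⟩, fun A M _ hM hcard hκ hA hℓ => ?_⟩
  · obtain ⟨β, hβ, rfl⟩ := mem_graphOn.1 hp
    exact ⟨β, F β, hβ, hrank β hβ, rfl⟩
  · obtain ⟨β, -, h1⟩ := mem_graphOn.1 hA
    obtain ⟨β', -, h2⟩ := mem_graphOn.1 hB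
    obtain ⟨rfl, rfl⟩ := ZFSet.pair_injective h1
    obtain ⟨rfl, rfl⟩ := ZFSet.pair_injective h2
    rfl
  · by_contra hno
    obtain ⟨e⟩ := Cardinal.eq.1 hcard
    have hex : IsCounterexample (graphOn F κ) κ A M fun α =>
        if h : α ∈ κ then (e.symm ⟨α, h⟩ : ZFSet.{u}) else ∅ := by
      refine ⟨hM, fun α hα => ?_, fun x hx => ⟨e ⟨x, hx⟩, (e ⟨x, hx⟩).2, ?_⟩, hκ, hA, hℓ, hno⟩
      · rw [dif_pos hα]
        exact (e.symm ⟨α, hα⟩).2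
      · have : ((e ⟨x, hx⟩ : κ.toSet) : ZFSet.{u}) ∈ κ := (e ⟨x, hx⟩).2
        rw [dif_pos this]
        simp
    refine not_eventually_isCounterexample hU hrank ?_
    filter_upwards [hex.eventually_exists hU hrank] with γ hγ
    exact (hF γ).resolve_right fun h => h.2 hγ

end LaverDiamond

/-- If `κ` is a measurable cardinal, then `LD^wc_κ` holds. -/
theorem LDwc_of_measurable (κ : ZFSet.{u}) (h : MeasurableCard κ) :
    LDwc κ := by
  obtain ⟨E⟩ := h
  exact E.isNormalUltrafilter.lDwc
end
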